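/- arXiv:2109.08088 — 3 statements merged into one kernel-verified Lean document; each statement's English description precedes it below -/
import Mathlib

section
/- Let (Λ, q) be a non-degenerate integer lattice of rank at least 4 containing a nonzero isotropic vector. Then O(Λ) acts with infinitely many orbits on the set of ordered pairs (x, y) of primitive isotropic vectors of Λ with q(x, y) ≠ 0. -/
section IsotropicPairs

variable {Λ : Type*} [AddCommGroup Λ] [Module ℤ Λ]

/-- A vector pairing nontrivially with some `y` is a multiple of a primitive vector. -/
theorem exists_eq_smul_primitive (q : Λ →ₗ[ℤ] Λ →ₗ[ℤ] ℤ) (v y : Λ) (h : q v y ≠ 0) :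
    ∃ (d : ℤ) (u : Λ), v = d • u ∧ d ≠ 0 ∧
      ∀ (m : ℤ) (z : Λ), u = m • z → m = 1 ∨ m = -1 := by
  classical
  have hex : ∃ k : ℕ, ∃ (d : ℤ) (u : Λ), v = d • u ∧ (q u y).natAbs = k :=
    ⟨_, 1, v, by simp, rfl⟩
  obtain ⟨d, u, hv, hk⟩ := Nat.find_spec hex
  have hne : d * q u y ≠ 0 := by
    rw [hv] at h
    simpa using h
  refine ⟨d, u, hv, left_ne_zero_of_mul hne, fun m z hz => ?_⟩
  have hmin := Nat.find_min' hex ⟨d * m, z, by rw [hv, hz, smul_smul], rfl⟩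
  have hu : q u y = m * q z y := by simp [hz]
  have hu0 : m * q z y ≠ 0 := hu ▸ right_ne_zero_of_mul hne
  rw [← hk, hu, Int.natAbs_mul] at hmin
  have hz0 : 0 < (q z y).natAbs := Int.natAbs_pos.2 (right_ne_zero_of_mul hu0)
  have hm0 : 0 < m.natAbs := Int.natAbs_pos.2 (left_ne_zero_of_mul hu0)
  have hm1 : m.natAbs ≤ 1 := by
    by_contra! hlt
    nlinarith
  omega

/-- An isotropic vector of a non-degenerate lattice pairs nontrivially with another isotropic
vector. -/
theorem exists_isotropic_pairing_ne_zero (q : Λ →ₗ[ℤ] Λ →ₗ[ℤ] ℤ)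
    (hsymm : ∀ x y : Λ, q x y = q y x) (hnd : ∀ x : Λ, (∀ y : Λ, q x y = 0) → x = 0)
    {e : Λ} (he : e ≠ 0) (hee : q e e = 0) : ∃ f : Λ, q f f = 0 ∧ q e f ≠ 0 := by
  obtain ⟨y, hy⟩ : ∃ y, q e y ≠ 0 := by
    by_contra! h
    exact he (hnd e h)
  refine ⟨(2 * q e y) • y - q y y • e, ?_, ?_⟩
  · simp [hee, hsymm y e]
    ring
  · simp [hee, hy]

/-- In rank at least three, the orthogonal complement of a pair of isotropic vectors `e`, `f`
with `q e f ≠ 0` contains an anisotropic vector. -/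
theorem exists_anisotropic_orthogonal [Module.Free ℤ Λ] [Module.Finite ℤ Λ]
    (q : Λ →ₗ[ℤ] Λ →ₗ[ℤ] ℤ)
    (hsymm : ∀ x y : Λ, q x y = q y x) (hnd : ∀ x : Λ, (∀ y : Λ, q x y = 0) → x = 0)
    (hrank : 3 ≤ Module.finrank ℤ Λ) {e f : Λ} (hee : q e e = 0) (hff : q f f = 0)
    (hef : q e f ≠ 0) : ∃ w : Λ, q w e = 0 ∧ q w f = 0 ∧ q w w ≠ 0 := by
  by_contra! H
  have horth : ∀ w w' : Λ, q w e = 0 → q w f = 0 → q w' e = 0 → q w' f = 0 → q w w' = 0 := by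
    intro w w' h1 h2 h3 h4
    have h := H (w + w') (by simp [h1, h3]) (by simp [h2, h4])
    simp only [map_add, LinearMap.add_apply, H w h1 h2, H w' h3 h4, hsymm w' w] at h
    omega
  have hzero : ∀ w : Λ, q w e = 0 → q w f = 0 → w = 0 := by
    intro w h1 h2
    refine hnd w fun z => ?_
    have h := horth w (q e f • z - q z f • e - q z e • f) h1 h2
      (by simp [hee, hsymm f e, mul_comm]) (by simp [hff, mul_comm])
    simpa [h1, h2, hef] using h
  have hinj : Function.Injective ((q.flip e).prod (q.flip f)) := by
    rw [injective_iff_map_eq_zero]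
    intro w hw
    exact hzero w (congrArg Prod.fst hw) (congrArg Prod.snd hw)
  have hle := LinearMap.finrank_le_finrank_of_injective hinj
  simp at hle
  omega

/-- The pairings of a primitive isotropic vector with primitive isotropic vectors are
unbounded. -/
theorem exists_primitive_isotropic_pairing_gt (q : Λ →ₗ[ℤ] Λ →ₗ[ℤ] ℤ)
    (hsymm : ∀ x y : Λ, q x y = q y x) {e f w : Λ} (hee : q e e = 0) (hff : q f f = 0)
    (hef : q e f ≠ 0) (hwe : q w e = 0) (hwf : q w f = 0) (hww : q w w ≠ 0) (M : ℕ) :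
    ∃ u : Λ, (∀ (m : ℤ) (z : Λ), u = m • z → m = 1 ∨ m = -1) ∧ q u u = 0 ∧
      (M : ℤ) < |q u e| := by
  set c := q e f with hc
  set n := q w w with hn
  have hfe : q f e = c := hsymm f e
  have hew : q e w = 0 := by rw [hsymm, hwe]
  have hfw : q f w = 0 := by rw [hsymm, hwf]
  set b : ℤ := 2 * c ^ 2 * (M + 1) with hb
  set v : Λ := (2 * c) • e + (2 * c * b) • w - (b ^ 2 * n) • f with hv
  have hvf : q v f = 2 * c ^ 2 := by
    simp [hv, hff, hwf, ← hc]
    ring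
  have hve : q v e = -(b ^ 2 * n * c) := by simp [hv, hee, hwe, hfe]
  have hvv : q v v = 0 := by
    simp [hv, hee, hff, hwe, hwf, hew, hfw, hfe, ← hc, ← hn]
    ring
  have hc2 : 0 < c ^ 2 := by positivity
  obtain ⟨d, u, hu, hd, hprim⟩ := exists_eq_smul_primitive q v f (by rw [hvf]; positivity)
  have huf : d * q u f = 2 * c ^ 2 := by rw [← hvf, hu]; simp
  have hue : d * q u e = -(b ^ 2 * n * c) := by rw [← hve, hu]; simp
  refine ⟨u, hprim, ?_, ?_⟩
  · rw [hu] at hvv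
    simpa [hd] using hvv
  · have hdle : |d| ≤ 2 * c ^ 2 :=
      Int.le_of_dvd (by positivity) ((abs_dvd _ _).2 ⟨_, huf.symm⟩)
    have hnc : 1 ≤ |n * c| := Int.one_le_abs (mul_ne_zero hww hef)
    have habs : |d| * |q u e| = b ^ 2 * |n * c| := by
      rw [← abs_mul, hue, abs_neg, mul_assoc, abs_mul, abs_of_nonneg (sq_nonneg b)]
    have hb1 : 1 ≤ b := by
      have : 0 < b := by positivity
      omega
    by_contra! hle
    have h1 : |d| * |q u e| ≤ 2 * c ^ 2 * M :=
      mul_le_mul hdle hle (abs_nonneg _) (by positivity)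
    nlinarith

end IsotropicPairs


/-- Let `(Λ, q)` be a non-degenerate integer lattice of rank at
least 4 containing a nonzero isotropic vector. Then `O(Λ)` acts with infinitely many
orbits on the set of ordered pairs `(x, y)` of primitive isotropic vectors of `Λ`
with `q(x, y) ≠ 0`. -/
theorem infinitely_many_orbits_on_isotropic_pairs
    {Λ : Type*} [AddCommGroup Λ] [Module ℤ Λ] [Module.Free ℤ Λ] [Module.Finite ℤ Λ]
    (q : Λ →ₗ[ℤ] Λ →ₗ[ℤ] ℤ)
    (hsymm : ∀ x y : Λ, q x y = q y x)
    (hnd : ∀ x : Λ, (∀ y : Λ, q x y = 0) → x = 0)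
    (hrank : 4 ≤ Module.finrank ℤ Λ)
    (hisotropic : ∃ x : Λ, x ≠ 0 ∧ q x x = 0) :
    ¬ ∃ T : Finset (Λ × Λ),
        ∀ x y : Λ,
          (∀ (m : ℤ) (z : Λ), x = m • z → m = 1 ∨ m = -1) →
          (∀ (m : ℤ) (z : Λ), y = m • z → m = 1 ∨ m = -1) →
          q x x = 0 → q y y = 0 → q x y ≠ 0 →
          ∃ p ∈ T, ∃ g : Λ ≃ₗ[ℤ] Λ,
            (∀ a b : Λ, q (g a) (g b) = q a b) ∧ g p.1 = x ∧ g p.2 = y := by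
  rintro ⟨T, hT⟩
  obtain ⟨x, hx, hxx⟩ := hisotropic
  obtain ⟨y, -, hxy⟩ := exists_isotropic_pairing_ne_zero q hsymm hnd hx hxx
  obtain ⟨d, e, rfl, hd, he⟩ := exists_eq_smul_primitive q x y hxy
  have hee : q e e = 0 := by simpa [hd] using hxx
  have he0 : e ≠ 0 := by
    rintro rfl
    simp at hxy
  obtain ⟨f, hff, hef⟩ := exists_isotropic_pairing_ne_zero q hsymm hnd he0 hee
  obtain ⟨w, hwe, hwf, hww⟩ :=
    exists_anisotropic_orthogonal q hsymm hnd (by omega) hee hff hef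
  obtain ⟨u, hu, huu, hlt⟩ := exists_primitive_isotropic_pairing_gt q hsymm hee hff hef hwe hwf
    hww (T.sup fun p => (q p.1 p.2).natAbs)
  have hue : q u e ≠ 0 := abs_pos.1 (lt_of_le_of_lt (Int.natCast_nonneg _) hlt)
  obtain ⟨p, hp, g, hg, rfl, rfl⟩ := hT u e hu he huu hee hue
  have hle := Finset.le_sup (f := fun p : Λ × Λ => (q p.1 p.2).natAbs) hp
  rw [hg, Int.abs_eq_natAbs, Nat.cast_lt] at hlt
  exact hle.not_gt hlt
end

section
/- Let (Λ, q) be a non-degenerate integer lattice. Suppose there exists A > 0 such that every primitive hyperbolic sublattice of Λ is isometric to U(N) for some N ≤ A. Then O(Λ) acts with finitely many orbits on the set of primitive hyperbolic sublattices of Λ. -/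
/-- A sublattice `L` of `(Λ, q)` is isometric to `U(N)` (Gram matrix `[[0,N],[N,0]]`). -/
def IsoUN {Λ : Type*} [AddCommGroup Λ] [Module ℤ Λ]
    (q : Λ →ₗ[ℤ] Λ →ₗ[ℤ] ℤ) (L : Submodule ℤ Λ) (N : ℤ) : Prop :=
  ∃ e : L ≃ₗ[ℤ] (Fin 2 → ℤ),
    ∀ a b : L, q a.1 b.1 = N * (e a 0 * e b 1 + e a 1 * e b 0)

section HyperbolicPlanes

variable {Λ : Type*} [AddCommGroup Λ]

theorem IsoUN.exists_generators {q : Λ →ₗ[ℤ] Λ →ₗ[ℤ] ℤ} {L : Submodule ℤ Λ} {N : ℤ}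
    (h : IsoUN q L N) :
    ∃ e f : Λ, L = Submodule.span ℤ {e, f} ∧ q e e = 0 ∧ q f f = 0 ∧ q e f = N := by
  obtain ⟨φ, hφ⟩ := h
  refine ⟨φ.symm ![1, 0], φ.symm ![0, 1], ?_, ?_, ?_, ?_⟩
  · ext x
    rw [Submodule.mem_span_pair]
    constructor
    · intro hx
      refine ⟨φ ⟨x, hx⟩ 0, φ ⟨x, hx⟩ 1, ?_⟩
      have : φ ⟨x, hx⟩ 0 • φ.symm ![1, 0] + φ ⟨x, hx⟩ 1 • φ.symm ![0, 1] = ⟨x, hx⟩ := by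
        apply φ.injective
        ext i
        fin_cases i <;> simp
      simpa using congrArg Subtype.val this
    · rintro ⟨a, b, rfl⟩
      exact L.add_mem (L.smul_mem _ (Subtype.prop _)) (L.smul_mem _ (Subtype.prop _))
  all_goals rw [hφ]; simp

theorem isoUN_span_pair {q : Λ →ₗ[ℤ] Λ →ₗ[ℤ] ℤ} (hsymm : ∀ x y, q x y = q y x)
    {e f : Λ} {N : ℤ} (hN : N ≠ 0) (he : q e e = 0) (hf : q f f = 0) (hef : q e f = N) :
    IsoUN q (Submodule.span ℤ {e, f}) N := by
  have hfe : q f e = N := by rw [hsymm, hef]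
  let ψ : (Fin 2 → ℤ) →ₗ[ℤ] Submodule.span ℤ {e, f} :=
    LinearMap.codRestrict _
      ((LinearMap.proj 0).smulRight e + (LinearMap.proj 1).smulRight f) (fun p => by
        rw [Submodule.mem_span_pair]
        exact ⟨p 0, p 1, by simp⟩)
  have hψ : ∀ p, (ψ p : Λ) = p 0 • e + p 1 • f := fun p => rfl
  have hbij : Function.Bijective ψ := by
    constructor
    · rw [← LinearMap.ker_eq_bot, LinearMap.ker_eq_bot']
      intro p hp
      have h0 : p 0 • e + p 1 • f = 0 := by rw [← hψ, hp]; rfl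
      have h1 := congrArg (fun x => q x e) h0
      have h2 := congrArg (fun x => q x f) h0
      simp [he, hf, hef, hfe, hN] at h1 h2
      ext i
      fin_cases i <;> simp [h1, h2]
    · rintro ⟨x, hx⟩
      obtain ⟨a, b, rfl⟩ := Submodule.mem_span_pair.1 hx
      exact ⟨![a, b], Subtype.ext (by simp [hψ])⟩
  refine ⟨(LinearEquiv.ofBijective ψ hbij).symm, fun a b => ?_⟩
  obtain ⟨p, rfl⟩ := (LinearEquiv.ofBijective ψ hbij).surjective a
  obtain ⟨r, rfl⟩ := (LinearEquiv.ofBijective ψ hbij).surjective b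
  simp only [LinearEquiv.ofBijective_apply, hψ]
  simp [he, hf, hef, hfe]
  ring

theorem IsoUN.dvd {q : Λ →ₗ[ℤ] Λ →ₗ[ℤ] ℤ} {L : Submodule ℤ Λ} {M N : ℤ}
    (hM : IsoUN q L M) (hN : IsoUN q L N) : M ∣ N := by
  obtain ⟨e, f, rfl, -, -, rfl⟩ := hN.exists_generators
  obtain ⟨φ, hφ⟩ := hM
  exact ⟨_, hφ ⟨e, Submodule.subset_span (by simp)⟩ ⟨f, Submodule.subset_span (by simp)⟩⟩

theorem exists_self_ne_zero {q : Λ →ₗ[ℤ] Λ →ₗ[ℤ] ℤ} (hsymm : ∀ x y, q x y = q y x)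
    (V : Submodule ℤ Λ) {x y : Λ} (hx : x ∈ V) (hy : y ∈ V) (hxy : q x y ≠ 0) :
    ∃ z ∈ V, q z z ≠ 0 := by
  by_contra! h
  have h1 := h _ (V.add_mem hx hy)
  simp [h _ hx, h _ hy, hsymm y x] at h1
  omega

/-- If the orthogonal complement of a primitive hyperbolic plane contains two orthogonal
anisotropic vectors, then there are primitive hyperbolic planes `U(M)` with `M` arbitrarily
large. -/
theorem exists_large_hyperbolic {q : Λ →ₗ[ℤ] Λ →ₗ[ℤ] ℤ} (hsymm : ∀ x y, q x y = q y x)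
    [Module.IsTorsionFree ℤ Λ] {e f u v : Λ} {N : ℤ} (hN : 0 < N)
    (hprim : ∀ (x : Λ) (n : ℤ), n ≠ 0 → n • x ∈ Submodule.span ℤ {e, f} →
      x ∈ Submodule.span ℤ {e, f})
    (he : q e e = 0) (hf : q f f = 0) (hef : q e f = N)
    (heu : q e u = 0) (hfu : q f u = 0) (hev : q e v = 0) (hfv : q f v = 0)
    (huv : q u v = 0) (hu : q u u ≠ 0) (hv : q v v ≠ 0) (B : ℤ) :
    ∃ (L : Submodule ℤ Λ) (M : ℤ), B < M ∧ 1 ≤ M ∧ IsoUN q L M ∧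
      ∀ (x : Λ) (n : ℤ), n ≠ 0 → n • x ∈ L → x ∈ L := by
  have hfe : q f e = N := by rw [hsymm, hef]
  have hue : q u e = 0 := by rw [hsymm, heu]
  have huf : q u f = 0 := by rw [hsymm, hfu]
  have hve : q v e = 0 := by rw [hsymm, hev]
  have hvf : q v f = 0 := by rw [hsymm, hfv]
  have hvu : q v u = 0 := by rw [hsymm, huv]
  generalize hα : q u u = α at hu
  generalize hγ : q v v = γ at hv
  set s : ℤ := |B| + 1 with hs
  have hs1 : 1 ≤ s := by have := abs_nonneg B; omega
  obtain ⟨a, ha⟩ : ∃ a, a = 1 + 4 * N ^ 2 * α * γ * s ^ 2 := ⟨_, rfl⟩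
  obtain ⟨w, hw⟩ : ∃ w, w = u + (2 * N * α * s) • v := ⟨_, rfl⟩
  obtain ⟨g, hg⟩ : ∃ g, g = a • f + (2 * N) • w - (2 * N * α) • e := ⟨_, rfl⟩
  have haB : s < |a| := by
    have h1 : 1 ≤ |α * γ| := Int.one_le_abs (mul_ne_zero hu hv)
    have h2 : |4 * N ^ 2 * α * γ * s ^ 2| = 4 * N ^ 2 * |α * γ| * s ^ 2 := by
      rw [mul_assoc (4 * N ^ 2), abs_mul, abs_mul, abs_of_pos (by positivity : 0 < 4 * N ^ 2),
        abs_of_nonneg (sq_nonneg s)]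
    have h3 : 1 ≤ N ^ 2 := by nlinarith
    have h4 : 1 ≤ N ^ 2 * |α * γ| := by nlinarith
    have h5 : s ^ 2 ≤ N ^ 2 * |α * γ| * s ^ 2 := by nlinarith [sq_nonneg s]
    have h6 : |4 * N ^ 2 * α * γ * s ^ 2| ≤ |a| + 1 := by
      have : 4 * N ^ 2 * α * γ * s ^ 2 = a - 1 := by rw [ha]; ring
      rw [this]
      exact (abs_sub a 1).trans (by simp)
    nlinarith
  have ha0 : a ≠ 0 := by rintro rfl; simp at haB; omega
  have hcopN : IsCoprime a N := ⟨1, -(4 * N * α * γ * s ^ 2), by rw [ha]; ring⟩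
  have hcopα : IsCoprime a (2 * α) := ⟨1, -(2 * N ^ 2 * γ * s ^ 2), by rw [ha]; ring⟩
  have heg : q e g = a * N := by simp [hg, hw, he, hef, heu, hev]
  have hgg : q g g = 0 := by
    simp [hg, hw, he, hef, heu, hev, hf, hfe, hfu, hfv, hue, huf, hα, huv, hve, hvf, hvu, hγ]
    rw [ha]; ring
  obtain ⟨ε, hε, hεa⟩ : ∃ ε : ℤ, ε * ε = 1 ∧ ε * a = |a| := by
    rcases abs_choice a with h | h
    · exact ⟨1, by simp, by simp [h]⟩
    · exact ⟨-1, by simp, by simp [h]⟩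
  have hM : 0 < |a| * N := by have := abs_pos.2 ha0; positivity
  refine ⟨Submodule.span ℤ {ε • e, g}, |a| * N, ?_, hM, ?_, ?_⟩
  · have := le_abs_self B
    nlinarith [abs_nonneg a]
  · apply isoUN_span_pair hsymm hM.ne'
    · simp [he]
    · exact hgg
    · simp [heg, ← hεa, mul_assoc]
  · intro x n hn hx
    obtain ⟨i, j, hij⟩ := Submodule.mem_span_pair.1 hx
    have hxu := congrArg (fun x => q x u) hij
    have hxe := congrArg (fun x => q x e) hij
    simp only [hg, hw, map_add, map_sub, map_smul, LinearMap.add_apply, LinearMap.sub_apply,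
      LinearMap.smul_apply, smul_eq_mul, heu, hfu, hα, hvu, he, hfe, hue, hve] at hxu hxe
    have hnN : n ∣ j * N := by
      obtain ⟨r, t, hrt⟩ := hcopα
      refine ⟨r * q x e + t * q x u, ?_⟩
      linear_combination (-j * N) * hrt + r * hxe + t * hxu
    obtain ⟨k, hk⟩ := hnN
    have hy : n • (x - (2 * k) • w) = (i * ε - j * (2 * N * α)) • e + (j * a) • f := by
      rw [smul_sub, ← hij, hg, smul_smul n, show n * (2 * k) = j * (2 * N) by
        linear_combination -2 * hk]
      module
    have hyL := hprim _ n hn (by rw [hy]; exact Submodule.mem_span_pair.2 ⟨_, _, rfl⟩)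
    obtain ⟨b, c, hbc⟩ := Submodule.mem_span_pair.1 hyL
    rw [← hbc] at hy
    have h1 := congrArg (fun x => q x e) hy
    have h2 := congrArg (fun x => q x f) hy
    simp only [map_add, map_smul, LinearMap.add_apply, LinearMap.smul_apply, smul_eq_mul,
      he, hfe, hf, hef] at h1 h2
    have h1' : n * c = j * a := mul_right_cancel₀ hN.ne' (by linear_combination h1)
    have h2' : n * b = i * ε - j * (2 * N * α) :=
      mul_right_cancel₀ hN.ne' (by linear_combination h2)
    obtain ⟨r, t, hrt⟩ := hcopN
    have hj : j = n * (r * c + t * k) := by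
      linear_combination (-j) * hrt - r * h1' + t * hk
    rw [Submodule.mem_span_pair]
    refine ⟨ε * (b + (r * c + t * k) * (2 * N * α)), r * c + t * k, ?_⟩
    apply smul_right_injective Λ hn
    dsimp only
    rw [← hij, smul_add, smul_smul, smul_smul, smul_smul, smul_smul, ← hj]
    congr 2
    linear_combination (b + (r * c + t * k) * (2 * N * α)) * n * hε + h2' - 2 * N * α * hj

/-- `e, f` is a standard basis of a plane `U(N)`, `v` is an orthogonal vector of norm `α`, and
`x ↦ (q x f, q x e, c x)` gives `N` times the coordinates with respect to `e, f, v`. -/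
structure AdaptedFrame (q : Λ →ₗ[ℤ] Λ →ₗ[ℤ] ℤ) (N α : ℤ) (e f v : Λ) (c : Λ →ₗ[ℤ] ℤ) : Prop where
  pos : 0 < N
  norm_ne_zero : α ≠ 0
  ee : q e e = 0
  ff : q f f = 0
  ef : q e f = N
  ev : q e v = 0
  fv : q f v = 0
  vv : q v v = α
  decomp : ∀ x, N • x = q x f • e + q x e • f + c x • v

/-- `N` times the coordinates of a vector with respect to a frame. -/
def frameCoords (q : Λ →ₗ[ℤ] Λ →ₗ[ℤ] ℤ) (e f : Λ) (c : Λ →ₗ[ℤ] ℤ) : Λ →ₗ[ℤ] ℤ × ℤ × ℤ :=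
  (q.flip f).prod ((q.flip e).prod c)

theorem frameCoords_apply (q : Λ →ₗ[ℤ] Λ →ₗ[ℤ] ℤ) (e f : Λ) (c : Λ →ₗ[ℤ] ℤ) (x : Λ) :
    frameCoords q e f c x = (q x f, q x e, c x) := rfl

namespace AdaptedFrame

variable {q : Λ →ₗ[ℤ] Λ →ₗ[ℤ] ℤ} {N α : ℤ} {e f v : Λ} {c : Λ →ₗ[ℤ] ℤ}

theorem norm_mul_apply (h : AdaptedFrame q N α e f v c) (x : Λ) : c x * α = N * q x v := by
  have := congrArg (fun x => q x v) (h.decomp x)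
  simp [h.ev, h.fv, h.vv] at this
  linarith

theorem apply_eq_of_orthogonal (h : AdaptedFrame q N α e f v c) {x : Λ} {k : ℤ}
    (hk : q x v = k * α) : c x = N * k :=
  mul_right_cancel₀ h.norm_ne_zero (by rw [h.norm_mul_apply, hk]; ring)

theorem sq_mul (hsymm : ∀ x y, q x y = q y x) (h : AdaptedFrame q N α e f v c) (x y : Λ) :
    N ^ 2 * q x y = N * (q x f * q y e + q x e * q y f) + c x * c y * α := by
  have h1 := congrArg (fun x => q x y) (h.decomp x)
  simp [hsymm e y, hsymm f y, hsymm v y] at h1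
  linear_combination N * h1 - c x * h.norm_mul_apply y

theorem frameCoords_e (h : AdaptedFrame q N α e f v c) :
    frameCoords q e f c e = (N, 0, 0) := by
  simp [frameCoords_apply, h.ee, h.ef, h.apply_eq_of_orthogonal (x := e) (k := 0) (by simp [h.ev])]

theorem frameCoords_f (hsymm : ∀ x y, q x y = q y x) (h : AdaptedFrame q N α e f v c) :
    frameCoords q e f c f = (0, N, 0) := by
  simp [frameCoords_apply, h.ff, hsymm f e, h.ef,
    h.apply_eq_of_orthogonal (x := f) (k := 0) (by simp [h.fv])]

theorem frameCoords_v (hsymm : ∀ x y, q x y = q y x) (h : AdaptedFrame q N α e f v c) :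
    frameCoords q e f c v = (0, 0, N) := by
  simp [frameCoords_apply, hsymm v e, hsymm v f, h.ev, h.fv,
    h.apply_eq_of_orthogonal (x := v) (k := 1) (by simp [h.vv])]

theorem frameCoords_injective [Module.IsTorsionFree ℤ Λ] (h : AdaptedFrame q N α e f v c) :
    Function.Injective (frameCoords q e f c) := by
  intro x y hxy
  simp only [frameCoords_apply, Prod.mk.injEq] at hxy
  apply smul_right_injective Λ h.pos.ne'
  dsimp only
  rw [h.decomp, h.decomp, hxy.1, hxy.2.1, hxy.2.2]

theorem mem_range_iff_emod (hsymm : ∀ x y, q x y = q y x) (h : AdaptedFrame q N α e f v c)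
    (i j k : ℤ) :
    (i, j, k) ∈ LinearMap.range (frameCoords q e f c) ↔
      (i % N, j % N, k % N) ∈ LinearMap.range (frameCoords q e f c) := by
  have key : (i, j, k) = (i % N, j % N, k % N) +
      frameCoords q e f c ((i / N) • e + (j / N) • f + (k / N) • v) := by
    simp only [map_add, map_smul, h.frameCoords_e, h.frameCoords_f hsymm,
      h.frameCoords_v hsymm]
    simp [Int.emod_add_ediv_mul]
  rw [key]
  exact Submodule.add_mem_iff_left _ (LinearMap.mem_range_self _ _)

theorem exists_isometry [Module.IsTorsionFree ℤ Λ] (hsymm : ∀ x y, q x y = q y x)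
    {e' f' v' : Λ} {c' : Λ →ₗ[ℤ] ℤ}
    (h : AdaptedFrame q N α e f v c) (h' : AdaptedFrame q N α e' f' v' c')
    (hrange : LinearMap.range (frameCoords q e f c) = LinearMap.range (frameCoords q e' f' c')) :
    ∃ g : Λ ≃ₗ[ℤ] Λ, (∀ x y, q (g x) (g y) = q x y) ∧ g e = e' ∧ g f = f' := by
  let g : Λ ≃ₗ[ℤ] Λ := (LinearEquiv.ofInjective _ h.frameCoords_injective).trans
    ((LinearEquiv.ofEq _ _ hrange).trans (LinearEquiv.ofInjective _ h'.frameCoords_injective).symm)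
  have hg : ∀ x, frameCoords q e' f' c' (g x) = frameCoords q e f c x := by
    intro x
    have : LinearEquiv.ofInjective _ h'.frameCoords_injective (g x) =
        LinearEquiv.ofEq _ _ hrange (LinearEquiv.ofInjective _ h.frameCoords_injective x) :=
      LinearEquiv.apply_symm_apply _ _
    exact congrArg Subtype.val this
  refine ⟨g, fun x y => ?_, ?_, ?_⟩
  · have hx := hg x
    have hy := hg y
    simp only [frameCoords_apply, Prod.mk.injEq] at hx hy
    apply mul_left_cancel₀ (pow_ne_zero 2 h.pos.ne')
    rw [h'.sq_mul hsymm, h.sq_mul hsymm, hx.1, hx.2.1, hx.2.2, hy.1, hy.2.1, hy.2.2]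
  · apply h'.frameCoords_injective
    rw [hg, h.frameCoords_e, h'.frameCoords_e]
  · apply h'.frameCoords_injective
    rw [hg, h.frameCoords_f hsymm, h'.frameCoords_f hsymm]

/-- The norms of the third vectors of any two frames are related by divisibility. -/
theorem norm_dvd (hsymm : ∀ x y, q x y = q y x) (hnd : ∀ x, (∀ y, q x y = 0) → x = 0)
    {N₀ α₀ : ℤ} {e₀ f₀ v₀ : Λ} {c₀ : Λ →ₗ[ℤ] ℤ}
    (h₀ : AdaptedFrame q N₀ α₀ e₀ f₀ v₀ c₀) (h : AdaptedFrame q N α e f v c)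
    (hgen : ∀ y, q e y = 0 → q f y = 0 → ∃ k : ℤ, y = k • v) :
    α ∣ N₀ * α₀ * N := by
  let z := (α₀ * c e₀) • f₀ + (α₀ * c f₀) • e₀ + (N₀ * c v₀) • v₀
  have hz : ∀ x, q z x = N₀ * α₀ * c x := by
    intro x
    have h1 := congrArg c (h₀.decomp x)
    simp only [map_add, map_smul, smul_eq_mul] at h1
    simp only [z, map_add, map_smul, LinearMap.add_apply, LinearMap.smul_apply, smul_eq_mul,
      hsymm _ x]
    linear_combination -α₀ * h1 - c v₀ * h₀.norm_mul_apply x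
  have hαz : α • z = (N₀ * α₀ * N) • v := by
    rw [← sub_eq_zero]
    apply hnd
    intro y
    simp only [map_sub, map_smul, LinearMap.sub_apply, LinearMap.smul_apply, smul_eq_mul, hz,
      hsymm v y]
    linear_combination N₀ * α₀ * h.norm_mul_apply y
  have he := congrArg Prod.snd (congrArg Prod.snd (h.frameCoords_e))
  have hf := congrArg Prod.snd (congrArg Prod.snd (h.frameCoords_f hsymm))
  simp only [frameCoords_apply] at he hf
  obtain ⟨k, hk⟩ := hgen z (by rw [hsymm, hz, he, mul_zero]) (by rw [hsymm, hz, hf, mul_zero])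
  have h2 := congrArg (fun x => q x v) hαz
  simp only [hk, map_smul, LinearMap.smul_apply, smul_eq_mul, h.vv] at h2
  exact ⟨k, mul_right_cancel₀ h.norm_ne_zero (by linear_combination -h2)⟩

end AdaptedFrame

/-- If the orthogonal complement of `⟨e, f⟩` is nonzero and contains no two orthogonal
anisotropic vectors, then it has rank one, and a generator completes `e, f` to a frame. -/
theorem exists_adaptedFrame {q : Λ →ₗ[ℤ] Λ →ₗ[ℤ] ℤ} [Module.IsTorsionFree ℤ Λ]
    (hsymm : ∀ x y, q x y = q y x) (hnd : ∀ x, (∀ y, q x y = 0) → x = 0)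
    {e f : Λ} {N : ℤ} (hN : 0 < N) (he : q e e = 0) (hf : q f f = 0) (hef : q e f = N)
    (hperp : ∃ y, q e y = 0 ∧ q f y = 0 ∧ y ≠ 0)
    (hno : ∀ u v, q e u = 0 → q f u = 0 → q e v = 0 → q f v = 0 → q u v = 0 → q u u ≠ 0 →
      q v v = 0) :
    ∃ (α : ℤ) (v : Λ) (c : Λ →ₗ[ℤ] ℤ), AdaptedFrame q N α e f v c ∧
      ∀ y, q e y = 0 → q f y = 0 → ∃ k : ℤ, y = k • v := by
  have hfe : q f e = N := by rw [hsymm, hef]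
  let V : Submodule ℤ Λ := LinearMap.ker (q e) ⊓ LinearMap.ker (q f)
  have hV : ∀ y, y ∈ V ↔ q e y = 0 ∧ q f y = 0 := fun y => by simp [V]
  let p : Λ →ₗ[ℤ] Λ := N • LinearMap.id - (q.flip f).smulRight e - (q.flip e).smulRight f
  have hp : ∀ x, p x = N • x - q x f • e - q x e • f := fun x => by simp [p]
  have hpV : ∀ x, p x ∈ V := by
    intro x
    rw [hV]
    constructor <;> simp [hp, he, hf, hef, hfe, hsymm x e, hsymm x f] <;> ring
  have hqp : ∀ y ∈ V, ∀ x, q y (p x) = N * q y x := by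
    intro y hy x
    rw [hV] at hy
    simp [hp, hsymm y e, hsymm y f, hy.1, hy.2]
  obtain ⟨u, huV, hu⟩ : ∃ u ∈ V, q u u ≠ 0 := by
    obtain ⟨y, hey, hfy, hy0⟩ := hperp
    have hyV : y ∈ V := (hV y).2 ⟨hey, hfy⟩
    obtain ⟨x, hx⟩ : ∃ x, q y x ≠ 0 := by
      by_contra! h
      exact hy0 (hnd y h)
    exact exists_self_ne_zero hsymm V hyV (hpV x) (by
      rw [hqp y hyV]; exact mul_ne_zero hN.ne' hx)
  have hmin : ∃ v, (v ∈ V ∧ q v v ≠ 0) ∧ ∀ y, y ∈ V ∧ q y y ≠ 0 →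
      (q v v).natAbs ≤ (q y y).natAbs := by
    obtain ⟨v, hv, hle⟩ := WellFounded.has_min
      (InvImage.wf (fun y : Λ => (q y y).natAbs) Nat.lt_wfRel.wf) {y | y ∈ V ∧ q y y ≠ 0}
      ⟨u, huV, hu⟩
    exact ⟨v, hv, fun y hy => not_lt.1 (hle y hy)⟩
  obtain ⟨v, ⟨hvV, hv⟩, hvmin⟩ := hmin
  have hprop : ∀ y ∈ V, q v v • y = q y v • v := by
    intro y hy
    let W : Submodule ℤ Λ := V ⊓ LinearMap.ker (q v)
    have hr : ∀ y ∈ V, q v v • y - q y v • v ∈ W := by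
      intro y hy
      refine ⟨V.sub_mem (V.smul_mem _ hy) (V.smul_mem _ hvV), ?_⟩
      simp [hsymm v y]; ring
    rw [← sub_eq_zero]
    by_contra hne
    obtain ⟨x, hx⟩ : ∃ x, q (q v v • y - q y v • v) x ≠ 0 := by
      by_contra! h
      exact hne (hnd _ h)
    obtain ⟨z, hz, hzz⟩ := exists_self_ne_zero hsymm W (hr y hy) (hr (p x) (hpV x)) (by
      have h1 := LinearMap.mem_ker.1 (Submodule.mem_inf.1 (hr y hy)).2
      rw [hsymm] at h1
      rw [map_sub, map_smul, map_smul, h1, hqp _ (hr y hy).1, smul_zero, sub_zero, smul_eq_mul]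
      exact mul_ne_zero hv (mul_ne_zero hN.ne' hx))
    have hzV := (hV z).1 hz.1
    have hvV' := (hV v).1 hvV
    exact hzz (hno v z hvV'.1 hvV'.2 hzV.1 hzV.2 hz.2 hv)
  have hgen : ∀ y ∈ V, ∃ k : ℤ, y = k • v := by
    intro y hy
    refine ⟨q y v / q v v, ?_⟩
    obtain ⟨y', hy'⟩ : ∃ y', y' = y - (q y v / q v v) • v := ⟨_, rfl⟩
    have hy'V : y' ∈ V := hy' ▸ V.sub_mem hy (V.smul_mem _ hvV)
    have hr : q y' v = q y v % q v v := by
      simp [hy', Int.emod_def, mul_comm]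
    have h1 := hprop y' hy'V
    have h2 := congrArg (q y') h1
    simp only [map_smul, smul_eq_mul] at h2
    have hlt := Int.emod_lt_abs (q y v) hv
    have hnn := Int.emod_nonneg (q y v) hv
    rw [← hr] at hlt hnn
    have hzero : q y' y' = 0 := by
      by_contra hne
      have hle := hvmin y' ⟨hy'V, hne⟩
      have hle' : |q v v| ≤ |q y' y'| := by
        rw [Int.abs_eq_natAbs, Int.abs_eq_natAbs]; exact_mod_cast hle
      have h3 := congrArg abs h2
      rw [abs_mul, abs_mul, abs_of_nonneg hnn] at h3
      nlinarith [abs_pos.2 hv]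
    rw [hzero, mul_zero] at h2
    have h0 : q y' v = 0 := by simpa using h2.symm
    rw [h0, zero_smul] at h1
    have : y' = 0 := (smul_eq_zero.1 h1).resolve_left hv
    rw [← sub_eq_zero, ← hy', this]
  have hv0 : v ≠ 0 := by rintro rfl; simp at hv
  choose k hk using fun x => hgen (p x) (hpV x)
  have hinj := smul_left_injective ℤ hv0
  let c : Λ →ₗ[ℤ] ℤ :=
    { toFun := k
      map_add' := fun x y => hinj (by
        dsimp only
        rw [← hk, map_add, hk x, hk y, add_smul])
      map_smul' := fun a x => hinj (by
        dsimp only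
        rw [← hk, map_smul, hk x, smul_smul]; rfl) }
  have hvV' := (hV v).1 hvV
  refine ⟨q v v, v, c, ⟨hN, hv, he, hf, hef, hvV'.1, hvV'.2, rfl, fun x => ?_⟩,
    fun y h1 h2 => hgen y ((hV y).2 ⟨h1, h2⟩)⟩
  change N • x = q x f • e + q x e • f + k x • v
  rw [← hk, hp]
  abel

/-- A relation whose classes are separated by finitely many labels has a finite set of
representatives. -/
theorem exists_finset_representatives {ι κ : Type*} [Finite κ] (P : ι → Prop)
    (label : ι → κ → Prop) (R : ι → ι → Prop) (hlabel : ∀ x, P x → ∃ k, label x k)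
    (hR : ∀ x y k, label x k → label y k → R x y) :
    ∃ T : Finset ι, ∀ y, P y → ∃ x ∈ T, R x y := by
  classical
  have : Fintype {k // ∃ x, label x k} := Fintype.ofFinite _
  choose rep hrep using fun k : {k // ∃ x, label x k} => k.2
  refine ⟨Finset.univ.image rep, fun y hy => ?_⟩
  obtain ⟨k, hk⟩ := hlabel y hy
  exact ⟨rep ⟨k, y, hk⟩, Finset.mem_image_of_mem _ (Finset.mem_univ _), hR _ _ k (hrep _) hk⟩

end HyperbolicPlanes

/-- Let `(Λ, q)` be a non-degenerate integer lattice. If there is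
`A > 0` such that every primitive hyperbolic sublattice of `Λ` is isometric to `U(N)`
for some `N ≤ A`, then `O(Λ)` acts with finitely many orbits on the set of primitive
hyperbolic sublattices of `Λ`. -/
theorem bounded_hyperbolic_implies_finitely_many_orbits
    {Λ : Type*} [AddCommGroup Λ] [Module ℤ Λ] [Module.Free ℤ Λ] [Module.Finite ℤ Λ]
    (q : Λ →ₗ[ℤ] Λ →ₗ[ℤ] ℤ)
    (hsymm : ∀ x y : Λ, q x y = q y x)
    (hnd : ∀ x : Λ, (∀ y : Λ, q x y = 0) → x = 0)
    (A : ℤ) (hA : 0 < A)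
    (hbound : ∀ L : Submodule ℤ Λ,
      (∀ (x : Λ) (n : ℤ), n ≠ 0 → n • x ∈ L → x ∈ L) →
      (∃ N : ℤ, 1 ≤ N ∧ IsoUN q L N) →
      ∃ N : ℤ, 1 ≤ N ∧ N ≤ A ∧ IsoUN q L N) :
    ∃ T : Finset (Submodule ℤ Λ),
      ∀ L : Submodule ℤ Λ,
        (∀ (x : Λ) (n : ℤ), n ≠ 0 → n • x ∈ L → x ∈ L) →
        (∃ N : ℤ, 1 ≤ N ∧ IsoUN q L N) →
        ∃ L' ∈ T, ∃ g : Λ ≃ₗ[ℤ] Λ,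
          (∀ x y : Λ, q (g x) (g y) = q x y) ∧ L'.map (g : Λ →ₗ[ℤ] Λ) = L := by
  rename_i instModule _ _
  obtain rfl : instModule = AddCommGroup.toIntModule Λ := Subsingleton.elim _ _
  have hperp : ∀ (e f : Λ) (N : ℤ), 0 < N →
      (∀ (x : Λ) (n : ℤ), n ≠ 0 → n • x ∈ Submodule.span ℤ {e, f} →
        x ∈ Submodule.span ℤ {e, f}) →
      q e e = 0 → q f f = 0 → q e f = N → ∀ u v, q e u = 0 → q f u = 0 → q e v = 0 →
      q f v = 0 → q u v = 0 → q u u ≠ 0 → q v v = 0 := by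
    intro e f N hN hprim he hf hef u v heu hfu hev hfv huv hu
    by_contra hv
    obtain ⟨L, M, hAM, hM, hL, hLprim⟩ := exists_large_hyperbolic hsymm hN hprim he hf hef heu hfu
      hev hfv huv hu hv A
    obtain ⟨M', hM', hM'A, hL'⟩ := hbound L hLprim ⟨M, hM, hL⟩
    have := Int.le_of_dvd (by omega) (hL.dvd hL')
    omega
  let IsFrame (L : Submodule ℤ Λ) (N α : ℤ) (e f v : Λ) (c : Λ →ₗ[ℤ] ℤ) : Prop :=
    L = Submodule.span ℤ {e, f} ∧ N ≤ A ∧ AdaptedFrame q N α e f v c ∧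
      ∀ y, q e y = 0 → q f y = 0 → ∃ k : ℤ, y = k • v
  have hframe : ∀ L : Submodule ℤ Λ, L ≠ ⊤ →
      (∀ (x : Λ) (n : ℤ), n ≠ 0 → n • x ∈ L → x ∈ L) → (∃ N : ℤ, 1 ≤ N ∧ IsoUN q L N) →
      ∃ N α e f v c, IsFrame L N α e f v c := by
    intro L hL hprim hiso
    obtain ⟨N, hN, hNA, hLN⟩ := hbound L hprim hiso
    obtain ⟨e, f, rfl, he, hf, hef⟩ := hLN.exists_generators
    have hN' : 0 < N := by omega
    obtain ⟨α, v, c, h, hgen⟩ := exists_adaptedFrame hsymm hnd hN' he hf hef (by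
      by_contra! hzero
      apply hL
      rw [eq_top_iff]
      rintro x -
      apply hprim x N hN'.ne'
      have h0 := hzero (N • x - q x f • e - q x e • f)
        (by simp [he, hef, hsymm x e]; ring)
        (by simp [hf, hsymm f e, hef, hsymm x f]; ring)
      rw [Submodule.mem_span_pair]
      refine ⟨q x f, q x e, ?_⟩
      rw [sub_sub, sub_eq_zero] at h0
      exact h0.symm) (hperp e f N hN' hprim he hf hef)
    exact ⟨N, α, e, f, v, c, rfl, hNA, h, hgen⟩
  by_cases hex : ∃ L N α e f v c, IsFrame L N α e f v c
  swap
  · refine ⟨{⊤}, fun L hprim hiso => ⟨⊤, by simp, LinearEquiv.refl ℤ Λ, by simp, ?_⟩⟩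
    by_contra hL
    refine hex ⟨L, hframe L (fun h => hL ?_) hprim hiso⟩
    subst h
    simp
  obtain ⟨L₀, N₀, α₀, e₀, f₀, v₀, c₀, -, -, h₀, -⟩ := hex
  let B : ℤ := |N₀ * α₀| * A
  let P (L : Submodule ℤ Λ) : Prop := L ≠ ⊤ ∧
    (∀ (x : Λ) (n : ℤ), n ≠ 0 → n • x ∈ L → x ∈ L) ∧ (∃ N : ℤ, 1 ≤ N ∧ IsoUN q L N)
  let I := Set.Icc (0 : ℤ) A
  let label (L : Submodule ℤ Λ) (k : I × Set.Icc (-B) B × Set (I × I × I)) : Prop :=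
    ∃ e f v c, IsFrame L k.1 k.2.1 e f v c ∧
      k.2.2 = {t | ((t.1 : ℤ), (t.2.1 : ℤ), (t.2.2 : ℤ)) ∈ LinearMap.range (frameCoords q e f c)}
  let R (L' L : Submodule ℤ Λ) : Prop := ∃ g : Λ ≃ₗ[ℤ] Λ,
    (∀ x y : Λ, q (g x) (g y) = q x y) ∧ L'.map (g : Λ →ₗ[ℤ] Λ) = L
  obtain ⟨T, hT⟩ := exists_finset_representatives P label R (by
    rintro L ⟨hL, hprim, hiso⟩
    obtain ⟨N, α, e, f, v, c, rfl, hNA, h, hgen⟩ := hframe L hL hprim hiso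
    have hα : |α| ≤ B := by
      have hdvd := (abs_dvd_abs _ _).2 (AdaptedFrame.norm_dvd hsymm hnd h₀ h hgen)
      have hpos : 0 < |N₀ * α₀| := abs_pos.2 (mul_ne_zero h₀.pos.ne' h₀.norm_ne_zero)
      rw [abs_mul _ N, abs_of_pos h.pos] at hdvd
      exact (Int.le_of_dvd (mul_pos hpos h.pos) hdvd).trans
        (mul_le_mul_of_nonneg_left hNA hpos.le)
    exact ⟨(⟨N, h.pos.le, hNA⟩, ⟨α, abs_le.1 hα⟩, _), e, f, v, c, ⟨rfl, hNA, h, hgen⟩, rfl⟩) (by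
    rintro L' L ⟨⟨N, hN⟩, ⟨α, hα⟩, S⟩ ⟨e', f', v', c', ⟨rfl, hNA, h', -⟩, hS'⟩
      ⟨e, f, v, c, ⟨rfl, -, h, -⟩, hS⟩
    dsimp only at h h' hS hS' hNA
    have hrange : LinearMap.range (frameCoords q e' f' c') =
        LinearMap.range (frameCoords q e f c) := by
      ext ⟨i, j, k⟩
      rw [h'.mem_range_iff_emod hsymm, h.mem_range_iff_emod hsymm]
      have hmem : ∀ m : ℤ, m % N ∈ I := fun m =>
        ⟨Int.emod_nonneg _ h.pos.ne', (Int.emod_lt_of_pos _ h.pos).le.trans hNA⟩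
      exact Set.ext_iff.1 (hS'.symm.trans hS) (⟨_, hmem i⟩, ⟨_, hmem j⟩, ⟨_, hmem k⟩)
    obtain ⟨g, hg, hge, hgf⟩ := h'.exists_isometry hsymm h hrange
    refine ⟨g, hg, ?_⟩
    rw [Submodule.map_span, Set.image_pair]
    simp [hge, hgf])
  refine ⟨insert ⊤ T, fun L hprim hiso => ?_⟩
  by_cases hL : L = ⊤
  · subst hL
    exact ⟨⊤, by simp, LinearEquiv.refl ℤ Λ, by simp, by simp⟩
  · obtain ⟨L', hL', hR⟩ := hT L ⟨hL, hprim, hiso⟩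
    exact ⟨L', Finset.mem_insert_of_mem hL', hR⟩
end

section
/- (Meyer's theorem, used in the proof of the main theorem.) Let (Λ, q) be a non-degenerate indefinite integer lattice of rank at least 5. Then Λ contains a nonzero isotropic vector. -/
section Conics

variable {K : Type*} [Field K]

/-- The binary form `a x² + b y²` represents `s`. -/
def BinaryRep (a b s : K) : Prop := ∃ x y : K, a * x ^ 2 + b * y ^ 2 = s

/-- The conic `x² = A y² + B z²` has a point. -/
def ConicHasPoint (A B : K) : Prop :=
  ∃ x y z : K, (x ≠ 0 ∨ y ≠ 0 ∨ z ≠ 0) ∧ x ^ 2 = A * y ^ 2 + B * z ^ 2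

theorem BinaryRep.of_isotropic [CharZero K] {a b x y : K} (ha : a ≠ 0) (hb : b ≠ 0)
    (hxy : x ≠ 0 ∨ y ≠ 0) (h : a * x ^ 2 + b * y ^ 2 = 0) (s : K) : BinaryRep a b s := by
  have hx : x ≠ 0 := by
    rintro rfl
    rcases hxy with h0 | h0
    · exact h0 rfl
    · simp [hb, h0] at h
  refine ⟨x * (s / (4 * a * x ^ 2) + 1), y * (s / (4 * a * x ^ 2) - 1), ?_⟩
  have hy : b * y ^ 2 = -(a * x ^ 2) := by linear_combination h
  calc _ = a * x ^ 2 * (s / (4 * a * x ^ 2) + 1) ^ 2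
        + b * y ^ 2 * (s / (4 * a * x ^ 2) - 1) ^ 2 := by ring
    _ = s := by rw [hy]; field_simp; ring

theorem BinaryRep.mul_sq {a b s : K} (h : BinaryRep a b s) (r : K) :
    BinaryRep a b (s * r ^ 2) := by
  obtain ⟨x, y, h⟩ := h
  exact ⟨x * r, y * r, by rw [← h]; ring⟩

theorem BinaryRep.of_isSquare_div {a b s t : K} (h : BinaryRep a b s) (hs : s ≠ 0)
    (hts : IsSquare (t / s)) : BinaryRep a b t := by
  obtain ⟨r, hr⟩ := hts
  have : t = s * r ^ 2 := by rw [pow_two, ← hr, mul_div_cancel₀ _ hs]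
  exact this ▸ h.mul_sq r

theorem binaryRep_iff_conicHasPoint [CharZero K] {a b s : K} (ha : a ≠ 0) (hb : b ≠ 0)
    (hs : s ≠ 0) : BinaryRep a b s ↔ ConicHasPoint (-(a * b)) (a * s) := by
  constructor
  · rintro ⟨x, y, h⟩
    exact ⟨a * x, y, 1, by simp, by rw [← h]; ring⟩
  · rintro ⟨x, y, z, hne, h⟩
    by_cases hz : z = 0
    · subst hz
      refine BinaryRep.of_isotropic (x := x / a) (y := y) ha hb ?_ ?_ s
      · simpa [ha] using hne
      · field_simp
        linear_combination h
    · refine ⟨x / (a * z), y / z, ?_⟩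
      field_simp
      linear_combination h

theorem ConicHasPoint.symm {A B : K} (h : ConicHasPoint A B) : ConicHasPoint B A := by
  obtain ⟨x, y, z, hne, h⟩ := h
  exact ⟨x, z, y, by tauto, by rw [h]; ring⟩

theorem conicHasPoint_mul_sq {A B r : K} (hr : r ≠ 0) :
    ConicHasPoint A (r ^ 2 * B) ↔ ConicHasPoint A B := by
  constructor
  · rintro ⟨x, y, z, hne, h⟩
    exact ⟨x, y, r * z, by simpa [hr] using hne, by rw [h]; ring⟩
  · rintro ⟨x, y, z, hne, h⟩
    exact ⟨x, y, z / r, by simpa [hr] using hne, by rw [h]; field_simp⟩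

theorem ConicHasPoint.of_sq_sub_eq {A B B' t : K} (hB : B ≠ 0) (h : t ^ 2 - A = B * B')
    (hc : ConicHasPoint A B) : ConicHasPoint A B' := by
  obtain ⟨x, y, z, hne, hx⟩ := hc
  by_cases hz : z = 0
  · subst hz
    exact ⟨x, y, 0, hne, by rw [hx]; ring⟩
  · refine ⟨x * t + A * y, x + t * y, B * z, by simp [hB, hz], ?_⟩
    linear_combination (t ^ 2 - A) * hx + B * z ^ 2 * h

theorem conicHasPoint_of_isSquare {A : K} (h : IsSquare A) (B : K) : ConicHasPoint A B := by
  obtain ⟨r, rfl⟩ := h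
  exact ⟨r, 1, 0, by simp, by ring⟩

theorem ConicHasPoint.map {L : Type*} [Field L] (f : K →+* L) {A B : K}
    (h : ConicHasPoint A B) : ConicHasPoint (f A) (f B) := by
  obtain ⟨x, y, z, hne, h⟩ := h
  refine ⟨f x, f y, f z, by simpa using hne, ?_⟩
  rw [← map_pow, h]
  simp

theorem BinaryRep.map {L : Type*} [Field L] (f : K →+* L) {a b s : K}
    (h : BinaryRep a b s) : BinaryRep (f a) (f b) (f s) := by
  obtain ⟨x, y, rfl⟩ := h
  exact ⟨f x, f y, by simp⟩

end Conics

section Padic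

variable {p : ℕ} [hp : Fact p.Prime]

theorem Padic.norm_four_le_one : ‖(4 : ℚ_[p])‖ ≤ 1 := by
  simpa using Padic.norm_int_le_one (p := p) 4

theorem Padic.norm_four_of_ne_two (h2 : p ≠ 2) : ‖(4 : ℚ_[p])‖ = 1 := by
  have h : ¬ (p ∣ 4) := fun h => h2 <| by
    have : p ∣ 2 ^ 2 := h
    exact (Nat.prime_dvd_prime_iff_eq hp.out Nat.prime_two).1 (hp.out.dvd_of_dvd_pow this)
  have := (Padic.norm_natCast_eq_one_iff (p := p) (n := 4)).2
    ((Nat.Prime.coprime_iff_not_dvd hp.out).2 h)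
  simpa using this

theorem Padic.isSquare_of_norm_sub_one_lt {u : ℚ_[p]} (h : ‖u - 1‖ < ‖(4 : ℚ_[p])‖) :
    IsSquare u := by
  have hu : ‖u‖ ≤ 1 := by
    have h1 : ‖u - 1 + 1‖ ≤ max ‖u - 1‖ ‖(1 : ℚ_[p])‖ := Padic.nonarchimedean _ _
    rw [sub_add_cancel, norm_one] at h1
    exact h1.trans (max_le (h.le.trans Padic.norm_four_le_one) le_rfl)
  let U : ℤ_[p] := ⟨u, hu⟩
  have h1 : ‖1 - U‖ = ‖u - 1‖ := by
    rw [norm_sub_rev, PadicInt.norm_def]; rfl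
  have h2 : ‖(2 : ℤ_[p])‖ ^ 2 = ‖(4 : ℚ_[p])‖ := by
    rw [← norm_pow, PadicInt.norm_def]; norm_num; rfl
  have key := hensels_lemma (p := p) (R := ℤ_[p])
    (F := (Polynomial.X ^ 2 - Polynomial.C U : Polynomial ℤ_[p])) (a := (1 : ℤ_[p])) (by
      simpa [h1, h2, one_add_one_eq_two] using h)
  obtain ⟨z, hz, -⟩ := key
  refine ⟨(z : ℚ_[p]), ?_⟩
  have hz' : z ^ 2 = U := by simpa [sub_eq_zero] using hz
  have := congrArg (fun w : ℤ_[p] => (w : ℚ_[p])) hz'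
  simp only [PadicInt.coe_pow] at this
  rw [← pow_two, this]

theorem Padic.isSquare_div_of_norm_sub_lt {u v : ℚ_[p]} (hv : v ≠ 0)
    (h : ‖u - v‖ < ‖(4 : ℚ_[p])‖ * ‖v‖) : IsSquare (u / v) := by
  apply Padic.isSquare_of_norm_sub_one_lt
  rw [div_sub_one hv, norm_div, div_lt_iff₀ (norm_pos_iff.2 hv)]
  exact h

theorem Padic.norm_intCast_eq_one {n : ℤ} (h : ¬ (p : ℤ) ∣ n) : ‖(n : ℚ_[p])‖ = 1 :=
  Padic.norm_intCast_eq_one_iff.2 <|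
    ((Nat.prime_iff_prime_int.1 hp.out).coprime_iff_not_dvd.2 h).symm

theorem Padic.isSquare_intCast_of_zmod (h2 : p ≠ 2) {n : ℤ} (hn : ¬ (p : ℤ) ∣ n)
    (h : IsSquare (n : ZMod p)) : IsSquare (n : ℚ_[p]) := by
  obtain ⟨r, hr⟩ := h
  obtain ⟨r, rfl⟩ := ZMod.intCast_surjective r
  have hd : (p : ℤ) ∣ n - r * r := by
    rw [← ZMod.intCast_zmod_eq_zero_iff_dvd]
    simp [hr]
  have hr0 : ¬ (p : ℤ) ∣ r * r := fun h => hn (by simpa using dvd_add hd h)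
  have hne : ((r * r : ℤ) : ℚ_[p]) ≠ 0 := by
    rw [← norm_ne_zero_iff, Padic.norm_intCast_eq_one hr0]; exact one_ne_zero
  have hs : IsSquare ((n : ℚ_[p]) / ((r * r : ℤ) : ℚ_[p])) := by
    apply Padic.isSquare_div_of_norm_sub_lt hne
    rw [Padic.norm_four_of_ne_two h2, Padic.norm_intCast_eq_one hr0, one_mul, ← Int.cast_sub]
    exact Padic.norm_intCast_lt_one_iff.2 hd
  have : (n : ℚ_[p]) = (n : ℚ_[p]) / ((r * r : ℤ) : ℚ_[p]) * ((r * r : ℤ) : ℚ_[p]) := by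
    field_simp
  rw [this]
  refine hs.mul ⟨r, by push_cast; ring⟩

/-- A nondegenerate binary form over `ℤ/p`, `p` odd, represents `1`. -/
theorem ZMod.exists_mul_sq_add_mul_sq_eq_one (h2 : p ≠ 2) {A B : ZMod p} (hA : A ≠ 0)
    (hB : B ≠ 0) :
    ∃ y z : ZMod p, A * y ^ 2 + B * z ^ 2 = 1 := by
  have hcard : Fintype.card (ZMod p) % 2 = 1 := by
    rw [ZMod.card]; exact hp.out.eq_two_or_odd.resolve_left h2
  obtain ⟨y, z, h⟩ := FiniteField.exists_root_sum_quadratic (R := ZMod p)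
    (f := Polynomial.C A * Polynomial.X ^ 2 + Polynomial.C 0 * Polynomial.X + Polynomial.C 0)
    (g := Polynomial.C B * Polynomial.X ^ 2 + Polynomial.C 0 * Polynomial.X + Polynomial.C (-1))
    (Polynomial.degree_quadratic hA) (Polynomial.degree_quadratic hB) hcard
  refine ⟨y, z, ?_⟩
  simp at h
  linear_combination h

theorem Padic.conicHasPoint_of_units (h2 : p ≠ 2) {A B : ℤ} (hA : ¬ (p : ℤ) ∣ A)
    (hB : ¬ (p : ℤ) ∣ B) : ConicHasPoint (A : ℚ_[p]) (B : ℚ_[p]) := by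
  obtain ⟨y, z, h⟩ := ZMod.exists_mul_sq_add_mul_sq_eq_one h2
    (A := (A : ZMod p)) (B := (B : ZMod p))
    (by rwa [Ne, ZMod.intCast_zmod_eq_zero_iff_dvd])
    (by rwa [Ne, ZMod.intCast_zmod_eq_zero_iff_dvd])
  obtain ⟨y, rfl⟩ := ZMod.intCast_surjective y
  obtain ⟨z, rfl⟩ := ZMod.intCast_surjective z
  have h1 : ((A * y ^ 2 + B * z ^ 2 : ℤ) : ZMod p) = 1 := by push_cast; exact h
  have hnd : ¬ (p : ℤ) ∣ A * y ^ 2 + B * z ^ 2 := by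
    rw [← ZMod.intCast_zmod_eq_zero_iff_dvd, h1]; exact one_ne_zero
  obtain ⟨x, hx⟩ := Padic.isSquare_intCast_of_zmod h2 hnd (by rw [h1]; exact IsSquare.one)
  refine ⟨x, y, z, ?_, ?_⟩
  · by_contra! hcon
    rw [hcon.1, mul_zero] at hx
    exact hnd (by rw [Int.cast_eq_zero.1 hx]; exact dvd_zero _)
  · rw [pow_two, ← hx]; push_cast; ring

end Padic

section LocalGlobalConic

theorem ZMod.isSquare_intCast_of_forall_prime_pow {n : ℕ} (hn : n ≠ 0) {a : ℤ}
    (h : ∀ p k : ℕ, p.Prime → p ^ k ∣ n → IsSquare (a : ZMod (p ^ k))) :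
    IsSquare (a : ZMod n) := by
  induction n using Nat.recOnPosPrimePosCoprime with
  | prime_pow p k hp hk => exact h p k hp dvd_rfl
  | zero => exact absurd rfl hn
  | one => exact ⟨0, Subsingleton.elim _ _⟩
  | coprime m n hm hn' hco ihm ihn =>
    obtain ⟨r, hr⟩ := ihm (by omega) fun p k hp hd => h p k hp (hd.mul_right n)
    obtain ⟨s, hs⟩ := ihn (by omega) fun p k hp hd => h p k hp (hd.mul_left m)
    refine ⟨(ZMod.chineseRemainder hco).symm (r, s), ?_⟩
    apply (ZMod.chineseRemainder hco).injective
    rw [map_mul, RingEquiv.apply_symm_apply, map_intCast]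
    ext
    · simpa using hr
    · simpa using hs

variable {p : ℕ} [hp : Fact p.Prime]

theorem Padic.norm_sq_ne_inv (v : ℚ_[p]) : ‖v‖ ^ 2 ≠ (p : ℝ)⁻¹ := by
  have hp1 : (1 : ℝ) < p := by exact_mod_cast hp.out.one_lt
  by_cases hv : v = 0
  · subst hv
    have : (p : ℝ) ≠ 0 := by positivity
    simpa using this.symm
  · rw [Padic.norm_eq_zpow_neg_valuation hv, ← zpow_natCast, ← zpow_mul, ← zpow_neg_one]
    intro h
    have := zpow_right_injective₀ (by linarith) (by linarith) h
    push_cast at this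
    omega

theorem Padic.norm_intCast_eq_inv {B : ℤ} (h1 : (p : ℤ) ∣ B) (h2 : ¬ (p : ℤ) ^ 2 ∣ B) :
    ‖(B : ℚ_[p])‖ = (p : ℝ)⁻¹ := by
  obtain ⟨c, rfl⟩ := h1
  have hc : ¬ (p : ℤ) ∣ c := fun h => h2 (by rw [pow_two]; exact mul_dvd_mul_left _ h)
  push_cast
  rw [norm_mul, Padic.norm_intCast_eq_one hc, Padic.norm_p, mul_one]

theorem Padic.isSquare_zmod_of_conicHasPoint {A B : ℤ} (h1 : (p : ℤ) ∣ B)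
    (h2 : ¬ (p : ℤ) ^ 2 ∣ B) (h : ConicHasPoint (A : ℚ_[p]) (B : ℚ_[p])) :
    IsSquare (A : ZMod p) := by
  by_cases hA : (p : ℤ) ∣ A
  · rw [(ZMod.intCast_zmod_eq_zero_iff_dvd A p).2 hA]; exact IsSquare.zero
  obtain ⟨x, y, z, hne, h⟩ := h
  have hB := Padic.norm_intCast_eq_inv h1 h2
  have hA1 := Padic.norm_intCast_eq_one hA
  have par : ∀ w v : ℚ_[p], v ≠ 0 → ‖w ^ 2‖ ≠ ‖(B : ℚ_[p]) * v ^ 2‖ := by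
    intro w v hv he
    apply Padic.norm_sq_ne_inv (w / v)
    rw [norm_mul, hB, norm_pow, norm_pow] at he
    rw [norm_div, div_pow, he]
    have : ‖v‖ ≠ 0 := norm_ne_zero_iff.2 hv
    field_simp
  have hB0 : (B : ℚ_[p]) ≠ 0 := by
    rw [← norm_ne_zero_iff, hB]
    have := hp.out.ne_zero
    positivity
  have hy : y ≠ 0 := by
    rintro rfl
    by_cases hz : z = 0
    · subst hz; simp at h hne; exact hne h
    · exact par x z hz (by rw [h]; simp)
  set X := x / y
  set Z := z / y
  have hX : X ^ 2 - B * Z ^ 2 = A := by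
    simp only [X, Z]; field_simp; linear_combination h
  have hXZ : ‖X ^ 2‖ = 1 ∧ ‖(B : ℚ_[p]) * Z ^ 2‖ < 1 := by
    by_cases hZ : Z = 0
    · rw [hZ] at hX ⊢
      simp only [ne_eq, OfNat.ofNat_ne_zero, not_false_eq_true, zero_pow, mul_zero, sub_zero] at hX
      rw [hX]; simp [hA1]
    · have hm := Padic.add_eq_max_of_ne (q := X ^ 2) (r := -((B : ℚ_[p]) * Z ^ 2))
        (by rw [norm_neg]; exact par X Z hZ)
      rw [← sub_eq_add_neg, hX, hA1, norm_neg] at hm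
      have h1Z := par 1 Z hZ
      rw [one_pow, norm_one] at h1Z
      rcases max_choice ‖X ^ 2‖ ‖(B : ℚ_[p]) * Z ^ 2‖ with hc | hc
      · refine ⟨by rw [hm, hc], lt_of_le_of_ne ?_ h1Z.symm⟩
        rw [hm]; exact le_max_right _ _
      · rw [hc] at hm; exact absurd hm h1Z
  have hX1 : ‖X‖ ≤ 1 := by
    have := hXZ.1
    rw [norm_pow] at this
    exact ((pow_eq_one_iff_of_nonneg (norm_nonneg X) two_ne_zero).1 this).le
  let U : ℤ_[p] := ⟨X, hX1⟩
  refine ⟨PadicInt.toZMod U, ?_⟩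
  have hmem : U * U - (A : ℤ_[p]) ∈ RingHom.ker (PadicInt.toZMod (p := p)) := by
    rw [PadicInt.ker_toZMod, PadicInt.maximalIdeal_eq_span_p, Ideal.mem_span_singleton,
      ← PadicInt.norm_lt_one_iff_dvd, PadicInt.norm_def]
    have : ((U * U - (A : ℤ_[p]) : ℤ_[p]) : ℚ_[p]) = B * Z ^ 2 := by
      push_cast
      change X * X - A = _
      linear_combination hX
    rw [this]; exact hXZ.2
  rw [RingHom.mem_ker] at hmem
  simp only [map_sub, map_mul, map_intCast] at hmem
  linear_combination -hmem

theorem conicHasPoint_rat_of_local_of_le {A B : ℤ} (hA : A ≠ 0) (hB : B ≠ 0)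
    (hAB : A.natAbs ≤ B.natAbs)
    (ih : ∀ B' : ℤ, B' ≠ 0 → B'.natAbs < B.natAbs →
      (∀ (p : ℕ) [Fact p.Prime], ConicHasPoint (A : ℚ_[p]) (B' : ℚ_[p])) →
      ConicHasPoint (A : ℝ) (B' : ℝ) → ConicHasPoint (A : ℚ) (B' : ℚ))
    (hloc : ∀ (p : ℕ) [Fact p.Prime], ConicHasPoint (A : ℚ_[p]) (B : ℚ_[p]))
    (hreal : ConicHasPoint (A : ℝ) (B : ℝ)) : ConicHasPoint (A : ℚ) (B : ℚ) := by
  by_cases hsq : Squarefree B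
  swap
  · simp only [Squarefree, not_forall] at hsq
    obtain ⟨d, ⟨B', rfl⟩, hd⟩ := hsq
    have hd0 : d ≠ 0 := by rintro rfl; simp at hB
    have hB' : B' ≠ 0 := by rintro rfl; simp at hB
    have hd2 : 2 ≤ d.natAbs := by
      rw [Int.isUnit_iff_natAbs_eq] at hd
      have := Int.natAbs_pos.2 hd0
      omega
    have hcast : ∀ {K : Type} [Field K] [CharZero K],
        ConicHasPoint (A : K) ((d * d * B' : ℤ) : K) ↔ ConicHasPoint (A : K) (B' : K) := by
      intro K _ _
      rw [← conicHasPoint_mul_sq (B := (B' : K)) (r := (d : K)) (Int.cast_ne_zero.2 hd0)]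
      push_cast
      rw [pow_two]
    rw [hcast]
    refine ih B' hB' ?_ (fun p _ => hcast.1 (hloc p)) (hcast.1 hreal)
    rw [Int.natAbs_mul, Int.natAbs_mul]
    have := Int.natAbs_pos.2 hB'
    have : 4 ≤ d.natAbs * d.natAbs := by nlinarith
    nlinarith
  by_cases hB1 : B.natAbs ≤ 1
  · have hB2 := Int.natAbs_pos.2 hB
    have hA2 := Int.natAbs_pos.2 hA
    have hA' : A = 1 ∨ A = -1 := by omega
    have hB' : B = 1 ∨ B = -1 := by omega
    rcases hA' with rfl | rfl
    · exact ⟨1, 1, 0, by simp, by simp⟩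
    rcases hB' with rfl | rfl
    · exact ⟨1, 0, 1, by simp, by simp⟩
    obtain ⟨x, y, z, hne, h⟩ := hreal
    exfalso
    push_cast at h
    have hx : x = 0 := by nlinarith [sq_nonneg x, sq_nonneg y, sq_nonneg z]
    have hy : y = 0 := by nlinarith [sq_nonneg x, sq_nonneg y, sq_nonneg z]
    have hz : z = 0 := by nlinarith [sq_nonneg x, sq_nonneg y, sq_nonneg z]
    simp [hx, hy, hz] at hne
  have hBn : B.natAbs ≠ 0 := by omega
  have : NeZero B.natAbs := ⟨hBn⟩
  obtain ⟨r, hr⟩ : IsSquare (A : ZMod B.natAbs) := by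
    refine ZMod.isSquare_intCast_of_forall_prime_pow hBn fun p k hp hd => ?_
    have := Fact.mk hp
    have hsq' := Int.squarefree_natAbs.2 hsq
    have hk : k ≤ 1 := by
      by_contra! hk
      have := hsq' p ((by rw [← pow_two]; exact pow_dvd_pow p hk : p * p ∣ p ^ k).trans hd)
      exact hp.one_lt.ne' (Nat.isUnit_iff.1 this)
    interval_cases k
    · rw [pow_zero]; exact ⟨0, Subsingleton.elim _ _⟩
    · rw [pow_one] at hd ⊢
      refine Padic.isSquare_zmod_of_conicHasPoint (Int.natCast_dvd.2 hd) (fun h2 => ?_) (hloc p)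
      have := hsq p (by rwa [← pow_two])
      rw [Int.isUnit_iff_natAbs_eq] at this
      exact hp.one_lt.ne' (by simpa using this)
  set t := r.valMinAbs with ht
  have htle : t.natAbs ≤ B.natAbs / 2 := ZMod.natAbs_valMinAbs_le r
  obtain ⟨B', hB'⟩ : B ∣ t ^ 2 - A := by
    rw [← Int.natAbs_dvd, ← ZMod.intCast_zmod_eq_zero_iff_dvd]
    push_cast
    rw [ht, ZMod.coe_valMinAbs, hr]; ring
  by_cases hB0 : B' = 0
  · subst hB0
    refine conicHasPoint_of_isSquare ⟨(t : ℚ), ?_⟩ _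
    have : A = t * t := by linarith
    rw [this]; push_cast; ring
  have hcast : ∀ {K : Type} [Field K] [CharZero K],
      ConicHasPoint (A : K) (B : K) ↔ ConicHasPoint (A : K) (B' : K) := by
    intro K _ _
    have hK : (t : K) ^ 2 - A = B * B' := by exact_mod_cast congrArg (Int.cast : ℤ → K) hB'
    exact ⟨.of_sq_sub_eq (Int.cast_ne_zero.2 hB) hK,
      .of_sq_sub_eq (Int.cast_ne_zero.2 hB0) (hK.trans (mul_comm _ _))⟩
  rw [hcast]
  refine ih B' hB0 ?_ (fun p _ => hcast.1 (hloc p)) (hcast.1 hreal)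
  have h1 : B.natAbs * B'.natAbs ≤ t.natAbs ^ 2 + A.natAbs := by
    rw [← Int.natAbs_mul, ← hB', ← Int.natAbs_pow]
    exact Int.natAbs_sub_le _ _
  have h2 : 2 * t.natAbs ≤ B.natAbs := by omega
  by_contra! hcon
  have h3 : B.natAbs * B.natAbs ≤ B.natAbs * B'.natAbs := Nat.mul_le_mul_left _ hcon
  have h4 : 4 * t.natAbs ^ 2 ≤ B.natAbs * B.natAbs := by
    calc 4 * t.natAbs ^ 2 = (2 * t.natAbs) * (2 * t.natAbs) := by ring
      _ ≤ _ := Nat.mul_le_mul h2 h2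
  have h5 : 2 * B.natAbs ≤ B.natAbs * B.natAbs := Nat.mul_le_mul_right _ (by omega)
  nlinarith

/-- The Hasse principle for conics. -/
theorem conicHasPoint_rat_of_local {A B : ℤ} (hA : A ≠ 0) (hB : B ≠ 0)
    (hloc : ∀ (p : ℕ) [Fact p.Prime], ConicHasPoint (A : ℚ_[p]) (B : ℚ_[p]))
    (hreal : ConicHasPoint (A : ℝ) (B : ℝ)) : ConicHasPoint (A : ℚ) (B : ℚ) := by
  induction hn : A.natAbs + B.natAbs using Nat.strong_induction_on generalizing A B with
  | _ n ih =>
    rcases le_total A.natAbs B.natAbs with h | h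
    · exact conicHasPoint_rat_of_local_of_le hA hB h
        (fun B' hB' hlt hl hr => ih _ (by omega) hA hB' hl hr rfl) hloc hreal
    · exact (conicHasPoint_rat_of_local_of_le hB hA h
        (fun A' hA' hlt hl hr => ih _ (by omega) hB hA' hl hr rfl) (fun p _ => (hloc p).symm)
        hreal.symm).symm

end LocalGlobalConic

section Approximation

theorem Padic.exists_int_approx_binaryRep {p : ℕ} [hp : Fact p.Prime] {a b : ℤ} {σ : ℚ_[p]}
    (hσ : σ ≠ 0) (h : BinaryRep (a : ℚ_[p]) b σ) :
    ∃ (x y : ℤ) (k : ℕ), ∀ x' y' : ℤ, (p : ℤ) ^ k ∣ x' - x → (p : ℤ) ^ k ∣ y' - y →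
      IsSquare (((a * x' ^ 2 + b * y' ^ 2 : ℤ) : ℚ_[p]) / σ) := by
  obtain ⟨x₀, y₀, h⟩ := h
  let F : ℚ_[p] × ℚ_[p] → ℚ_[p] := fun u => (a * u.1 ^ 2 + b * u.2 ^ 2) / σ
  have hF : Continuous F := by fun_prop
  have hF1 : F (x₀, y₀) = 1 := by simp only [F]; rw [h, div_self hσ]
  have h4 : 0 < ‖(4 : ℚ_[p])‖ := norm_pos_iff.2 (by norm_num)
  obtain ⟨δ, hδ, hball⟩ := Metric.continuous_iff.1 hF (x₀, y₀) _ h4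
  obtain ⟨r, hr⟩ := Padic.rat_dense p x₀ hδ
  obtain ⟨s, hs⟩ := Padic.rat_dense p y₀ hδ
  set D : ℤ := r.den * s.den with hD
  have hD0 : (D : ℚ_[p]) ≠ 0 := by
    rw [Int.cast_ne_zero, hD]; exact_mod_cast mul_ne_zero r.den_nz s.den_nz
  have hDpos : 0 < ‖(D : ℚ_[p])‖ := norm_pos_iff.2 hD0
  obtain ⟨k, hk⟩ := exists_pow_lt_of_lt_one (mul_pos hδ hDpos)
    (inv_lt_one_of_one_lt₀ (by exact_mod_cast hp.out.one_lt : (1 : ℝ) < p))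
  have close : ∀ (z : ℚ_[p]) (t : ℚ) (n n' : ℤ), ‖z - t‖ < δ → (n : ℚ_[p]) = D * t →
      (p : ℤ) ^ k ∣ n' - n → ‖(n' : ℚ_[p]) / D - z‖ < δ := by
    intro z t n n' hz hn hd
    have h1 : ‖(n' : ℚ_[p]) / D - t‖ < δ := by
      have : (n' : ℚ_[p]) / D - t = ((n' - n : ℤ) : ℚ_[p]) / D := by
        push_cast; rw [hn]; field_simp
      rw [this, norm_div, div_lt_iff₀ hDpos]
      refine lt_of_le_of_lt ((Padic.norm_int_le_pow_iff_dvd _ _).2 hd) ?_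
      rwa [zpow_neg, zpow_natCast, ← inv_pow]
    have h2 : (n' : ℚ_[p]) / D - z = ((n' : ℚ_[p]) / D - t) + -(z - t) := by ring
    rw [h2]
    exact lt_of_le_of_lt (Padic.nonarchimedean _ _) (max_lt h1 (by rwa [norm_neg]))
  refine ⟨r.num * s.den, s.num * r.den, k, fun x' y' hx hy => ?_⟩
  have hx' := close x₀ r _ x' hr (by
    rw [hD]; push_cast
    nth_rewrite 3 [← Rat.num_div_den r]
    push_cast
    have : (r.den : ℚ_[p]) ≠ 0 := Nat.cast_ne_zero.2 r.den_nz
    field_simp) hx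
  have hy' := close y₀ s _ y' hs (by
    rw [hD]; push_cast
    nth_rewrite 3 [← Rat.num_div_den s]
    push_cast
    have : (s.den : ℚ_[p]) ≠ 0 := Nat.cast_ne_zero.2 s.den_nz
    field_simp) hy
  have hlt := hball ((x' : ℚ_[p]) / D, (y' : ℚ_[p]) / D) (by
    rw [Prod.dist_eq, dist_eq_norm, dist_eq_norm]; exact max_lt hx' hy')
  rw [hF1, dist_eq_norm] at hlt
  have hsq := Padic.isSquare_of_norm_sub_one_lt hlt
  have : ((a * x' ^ 2 + b * y' ^ 2 : ℤ) : ℚ_[p]) / σ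
      = F ((x' : ℚ_[p]) / D, (y' : ℚ_[p]) / D) * (D * D) := by
    simp only [F]; push_cast; field_simp
  rw [this]
  exact hsq.mul ⟨_, rfl⟩

theorem Int.exists_forall_primeFactors_pow_dvd_sub (w : ℕ) (k : ℕ → ℕ) (x : ℕ → ℤ) :
    ∃ X : ℤ, ∀ p ∈ w.primeFactors, (p : ℤ) ^ k p ∣ X - x p := by
  obtain ⟨X, hX⟩ := Ideal.exists_forall_sub_mem_ideal
    (I := fun p : w.primeFactors => Ideal.span {((p : ℕ) : ℤ) ^ k p}) (by
      intro p q hpq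
      rw [Function.onFun, Ideal.isCoprime_span_singleton_iff]
      apply IsCoprime.pow
      rw [Nat.isCoprime_iff_coprime,
        Nat.coprime_primes (Nat.prime_of_mem_primeFactors p.2) (Nat.prime_of_mem_primeFactors q.2)]
      exact fun h => hpq (Subtype.ext h)) (fun p => x p)
  exact ⟨X, fun p hp => Ideal.mem_span_singleton.1 (hX ⟨p, hp⟩)⟩

theorem Int.exists_add_mul_sq_pos {A : ℤ} (hA : 0 < A) (C X : ℤ) {N : ℤ} (hN : 0 < N) :
    ∃ k : ℤ, 0 < A * (X + N * k) ^ 2 + C := by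
  refine ⟨|X| + |C| + 1, ?_⟩
  have h1 : |C| + 1 ≤ X + N * (|X| + |C| + 1) := by
    nlinarith [neg_abs_le X, abs_nonneg X, abs_nonneg C]
  have h2 : |C| + 1 ≤ (X + N * (|X| + |C| + 1)) ^ 2 := by nlinarith [abs_nonneg C]
  nlinarith [neg_abs_le C, abs_nonneg C]

/-- Weak approximation for values of a binary form. -/
theorem exists_int_binary_value {w : ℕ} {a b ε : ℤ} (hε : 0 < ε * a ∨ 0 < ε * b)
    (σ : ∀ (p : ℕ) [Fact p.Prime], ℚ_[p])
    (h : ∀ (p : ℕ) [Fact p.Prime], p ∈ w.primeFactors →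
      σ p ≠ 0 ∧ BinaryRep (a : ℚ_[p]) b (σ p)) :
    ∃ x y : ℤ, 0 < ε * (a * x ^ 2 + b * y ^ 2) ∧
      ∀ (p : ℕ) [Fact p.Prime], p ∈ w.primeFactors →
        IsSquare (((a * x ^ 2 + b * y ^ 2 : ℤ) : ℚ_[p]) / σ p) := by
  have hex : ∀ p : ℕ, ∃ (x y : ℤ) (k : ℕ), ∀ [Fact p.Prime], p ∈ w.primeFactors →
      ∀ x' y' : ℤ, (p : ℤ) ^ k ∣ x' - x → (p : ℤ) ^ k ∣ y' - y →
        IsSquare (((a * x' ^ 2 + b * y' ^ 2 : ℤ) : ℚ_[p]) / σ p) := by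
    intro p
    by_cases hp : p ∈ w.primeFactors
    · have := Fact.mk (Nat.prime_of_mem_primeFactors hp)
      obtain ⟨x, y, k, hk⟩ := Padic.exists_int_approx_binaryRep (h p hp).1 (h p hp).2
      exact ⟨x, y, k, fun _ => hk⟩
    · exact ⟨0, 0, 0, fun hp' => absurd hp' hp⟩
  choose x y k hk using hex
  obtain ⟨X, hX⟩ := Int.exists_forall_primeFactors_pow_dvd_sub w k x
  obtain ⟨Y, hY⟩ := Int.exists_forall_primeFactors_pow_dvd_sub w k y
  set N : ℤ := ∏ p ∈ w.primeFactors, (p : ℤ) ^ k p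
  have hN : 0 < N := Finset.prod_pos fun p hp => by
    have := (Nat.prime_of_mem_primeFactors hp).pos
    positivity
  have hdN : ∀ p ∈ w.primeFactors, (p : ℤ) ^ k p ∣ N := fun p hp =>
    Finset.dvd_prod_of_mem (fun p : ℕ => (p : ℤ) ^ k p) hp
  have hshift : ∀ (p : ℕ) (Z z l : ℤ), p ∈ w.primeFactors → (p : ℤ) ^ k p ∣ Z - z →
      (p : ℤ) ^ k p ∣ Z + N * l - z := fun p Z z l hp hZ => by
    rw [add_sub_right_comm]; exact dvd_add hZ ((hdN p hp).mul_right l)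
  rcases hε with hε | hε
  · obtain ⟨l, hl⟩ := Int.exists_add_mul_sq_pos hε (ε * b * Y ^ 2) X hN
    exact ⟨X + N * l, Y, by linarith, fun p _ hp =>
      hk p hp _ _ (hshift p X _ l hp (hX p hp)) (hY p hp)⟩
  · obtain ⟨l, hl⟩ := Int.exists_add_mul_sq_pos hε (ε * a * X ^ 2) Y hN
    exact ⟨X, Y + N * l, by linarith, fun p _ hp =>
      hk p hp _ _ (hX p hp) (hshift p Y _ l hp (hY p hp))⟩

theorem exists_squarefree_binaryRep {w : ℕ} {a b ε : ℤ} (hε1 : ε = 1 ∨ ε = -1)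
    (hε : 0 < ε * a ∨ 0 < ε * b)
    (σ : ∀ (p : ℕ) [Fact p.Prime], ℚ_[p])
    (h : ∀ (p : ℕ) [Fact p.Prime], p ∈ w.primeFactors →
      σ p ≠ 0 ∧ BinaryRep (a : ℚ_[p]) b (σ p)) :
    ∃ n : ℕ, Squarefree n ∧ BinaryRep (a : ℚ) b (ε * n) ∧
      ∀ (p : ℕ) [Fact p.Prime], p ∈ w.primeFactors → IsSquare ((ε * n : ℚ_[p]) / σ p) := by
  obtain ⟨x, y, hpos, hsq⟩ := exists_int_binary_value hε σ h
  set t := a * x ^ 2 + b * y ^ 2 with ht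
  have hεε : ε * ε = 1 := by rcases hε1 with rfl | rfl <;> norm_num
  obtain ⟨n, d, hd⟩ := Nat.sq_mul_squarefree (ε * t).toNat
  obtain ⟨hd, hn⟩ := hd
  have hd' : (d : ℤ) ^ 2 * n = ε * t := by
    rw [← Int.toNat_of_nonneg hpos.le, ← hd]; push_cast; ring
  have hd0 : d ≠ 0 := by rintro rfl; exact hpos.ne (by rw [← hd']; simp)
  have htn : t = ε * n * d ^ 2 := by linear_combination ε * hd'.symm - t * hεε
  refine ⟨n, hn, ⟨x / d, y / d, ?_⟩, fun p _ hp => ?_⟩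
  · have hQ : (a : ℚ) * x ^ 2 + b * y ^ 2 = ε * n * d ^ 2 := by exact_mod_cast ht.symm.trans htn
    have : (d : ℚ) ≠ 0 := Nat.cast_ne_zero.2 hd0
    field_simp
    linear_combination hQ
  · have := hsq p hp
    have hdp : (d : ℚ_[p]) ≠ 0 := Nat.cast_ne_zero.2 hd0
    have he : (ε * n : ℚ_[p]) / σ p = (t : ℚ_[p]) / σ p * ((d : ℚ_[p])⁻¹ * (d : ℚ_[p])⁻¹) := by
      rw [htn]; push_cast; field_simp
    rw [he]
    exact this.mul ⟨_, rfl⟩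

end Approximation

section Quaternary

theorem jacobiSym_eq_one_of_forall_prime {D : ℤ} {m : ℕ} (hm : m ≠ 0)
    (h : ∀ p : ℕ, p.Prime → p ∣ m → jacobiSym D p = 1) : jacobiSym D m = 1 := by
  induction m using Nat.recOnMul with
  | zero => exact absurd rfl hm
  | one => exact jacobiSym.one_right D
  | prime p hp => exact h p hp dvd_rfl
  | mul a b iha ihb =>
    obtain ⟨ha, hb⟩ := mul_ne_zero_iff.1 hm
    rw [jacobiSym.mul_right' D ha hb, iha ha fun p hp hd => h p hp (hd.mul_right b),
      ihb hb fun p hp hd => h p hp (hd.mul_left a), mul_one]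

theorem jacobiSym_congr_right {D : ℤ} {m n w : ℕ} (hm : Odd m) (hn : Odd n)
    (hw : 4 * D.natAbs ∣ w) (h : m ≡ n [MOD w]) : jacobiSym D m = jacobiSym D n := by
  rw [jacobiSym.mod_right D hm, jacobiSym.mod_right D hn, h.of_dvd hw]

theorem Padic.isSquare_zmod_pow {p : ℕ} [hp : Fact p.Prime] {M : ℤ}
    (h : IsSquare (M : ℚ_[p])) (k : ℕ) : IsSquare (M : ZMod (p ^ k)) := by
  obtain ⟨z, hz⟩ := h
  have hz1 : ‖z‖ ≤ 1 := by
    have := Padic.norm_int_le_one (p := p) M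
    rw [hz, norm_mul] at this
    nlinarith [norm_nonneg z]
  let Z : ℤ_[p] := ⟨z, hz1⟩
  have hZ : (M : ℤ_[p]) = Z * Z := by
    apply Subtype.ext
    simpa using hz
  refine ⟨PadicInt.toZModPow k Z, ?_⟩
  rw [← map_mul, ← hZ, map_intCast]

theorem jacobiSym_eq_one_of_isSquare_padic {D : ℤ} (hD : D ≠ 0) {M : ℕ}
    (hco : M.Coprime (2 * D.natAbs))
    (h : ∀ (p : ℕ) [Fact p.Prime], p ∣ 2 * D.natAbs → IsSquare (M : ℚ_[p])) :
    jacobiSym D M = 1 := by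
  have hn : 4 * D.natAbs ≠ 0 := by have := Int.natAbs_ne_zero.2 hD; omega
  have : NeZero (4 * D.natAbs) := ⟨hn⟩
  obtain ⟨r, hr⟩ : IsSquare ((M : ℤ) : ZMod (4 * D.natAbs)) := by
    refine ZMod.isSquare_intCast_of_forall_prime_pow hn fun p k hp hd => ?_
    have := Fact.mk hp
    rcases Nat.eq_zero_or_pos k with rfl | hk
    · rw [pow_zero]; exact ⟨0, Subsingleton.elim _ _⟩
    · refine Padic.isSquare_zmod_pow ?_ k
      have h1 : p ∣ 2 * (2 * D.natAbs) := by
        rw [← mul_assoc]; exact (dvd_pow_self p hk.ne').trans hd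
      have h2 : p ∣ 2 * D.natAbs := by
        rcases hp.dvd_mul.1 h1 with h | h
        · exact h.mul_right _
        · exact h
      simpa using h p h2
  have hmod : M ≡ r.val * r.val [MOD 4 * D.natAbs] := by
    rw [← ZMod.natCast_eq_natCast_iff]
    push_cast
    rw [ZMod.natCast_zmod_val]
    simpa using hr
  have hMco : M.Coprime (4 * D.natAbs) := by
    have h2 : M.Coprime 2 := hco.coprime_mul_right_right
    rw [show 4 * D.natAbs = 2 * (2 * D.natAbs) by ring]
    exact h2.mul_right hco
  have hrco : (r.val * r.val).Coprime (4 * D.natAbs) := by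
    rw [Nat.Coprime, ← hmod.gcd_eq]; exact hMco
  have hodd : ∀ n : ℕ, n.Coprime (4 * D.natAbs) → Odd n := fun n hn =>
    Nat.coprime_two_right.1 <| hn.coprime_dvd_right
      (⟨2 * D.natAbs, by ring⟩ : 2 ∣ 4 * D.natAbs)
  rw [jacobiSym_congr_right (hodd _ hMco) (hodd _ hrco) dvd_rfl hmod, ← pow_two,
    jacobiSym.pow_right]
  apply jacobiSym.sq_one
  rw [Int.gcd_eq_natAbs, Int.natAbs_natCast]
  exact (hrco.coprime_mul_right.coprime_dvd_right (dvd_mul_left _ _)).symm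

theorem jacobiSym_eq_one_of_binaryRep {a b ε : ℤ} (ha : a ≠ 0) (hb : b ≠ 0)
    (hε : ε = 1 ∨ ε = -1) {n m w : ℕ} (hn : Squarefree n) (hmn : m ∣ n)
    (hw : 2 * a * b ∣ (w : ℤ)) (hmw : m.Coprime w) (h : BinaryRep (a : ℚ) b (ε * n)) :
    jacobiSym (-(a * b)) m = 1 := by
  have hm0 : m ≠ 0 := fun h0 => hn.ne_zero (zero_dvd_iff.1 (h0 ▸ hmn))
  refine jacobiSym_eq_one_of_forall_prime hm0 fun p hp hpm => ?_
  have := Fact.mk hp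
  have hpw : ¬ p ∣ w := fun h => hp.one_lt.ne' (Nat.eq_one_of_dvd_coprimes hmw hpm h)
  have hpab : ¬ (p : ℤ) ∣ 2 * a * b := fun h => hpw (Int.natCast_dvd_natCast.1 (h.trans hw))
  have hpZ := Nat.prime_iff_prime_int.1 hp
  have hpa : ¬ (p : ℤ) ∣ a := fun h => hpab ((h.mul_left 2).mul_right b)
  have hpD : ¬ (p : ℤ) ∣ -(a * b) := fun h => hpab (by
    rw [dvd_neg] at h; rw [mul_assoc]; exact h.mul_left 2)
  have hn0 : (n : ℚ) ≠ 0 := Nat.cast_ne_zero.2 hn.ne_zero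
  have hε0 : (ε : ℚ) ≠ 0 := by rcases hε with rfl | rfl <;> norm_num
  have hc := ((binaryRep_iff_conicHasPoint (Int.cast_ne_zero.2 ha) (Int.cast_ne_zero.2 hb)
    (mul_ne_zero hε0 hn0)).1 h).map (algebraMap ℚ ℚ_[p])
  have hsq : IsSquare ((-(a * b) : ℤ) : ZMod p) := by
    refine Padic.isSquare_zmod_of_conicHasPoint (B := a * (ε * n)) ?_ ?_ ?_
    · exact ((Int.natCast_dvd_natCast.2 (hpm.trans hmn)).mul_left ε).mul_left a
    · intro hd
      have h1 : (p : ℤ) ^ 2 ∣ ε * n :=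
        (hpZ.coprime_iff_not_dvd.2 hpa).pow_left.dvd_of_dvd_mul_left hd
      have h2 : (p : ℤ) ^ 2 ∣ n := by
        rcases hε with rfl | rfl
        · simpa using h1
        · simpa using h1
      have h3 : p * p ∣ n := by rw [← pow_two]; exact_mod_cast h2
      exact hp.one_lt.ne' (Nat.isUnit_iff.1 (hn p h3))
    · simpa using hc
  rw [← jacobiSym.legendreSym.to_jacobiSym, legendreSym.eq_one_iff]
  · exact hsq
  · rwa [Ne, ZMod.intCast_zmod_eq_zero_iff_dvd]

theorem binaryRep_prime_of_binaryRep {a b ε : ℤ} (ha : a ≠ 0) (hb : b ≠ 0)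
    (hε : ε = 1 ∨ ε = -1) (hpos : 0 < ε * a ∨ 0 < ε * b) {e m w q : ℕ}
    (hem : e * m ≠ 0) (hw : 2 * a * b ∣ (w : ℤ)) (hew : e ∣ w)
    (hq : q.Prime) (hqw : ¬ q ∣ w)
    (hsq : ∀ (p : ℕ) [Fact p.Prime], p ∣ w → IsSquare (q / m : ℚ_[p]))
    (hJ : jacobiSym (-(a * b)) q = 1)
    (h : BinaryRep (a : ℚ) b (ε * (e * m : ℕ))) : BinaryRep (a : ℚ) b (ε * (e * q : ℕ)) := by
  obtain ⟨he0, hm0⟩ := mul_ne_zero_iff.1 hem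
  have hε0 : ε ≠ 0 := by rcases hε with rfl | rfl <;> norm_num
  have hs0 : ε * (e * q : ℕ) ≠ 0 :=
    mul_ne_zero hε0 (Nat.cast_ne_zero.2 (mul_ne_zero he0 hq.ne_zero))
  have conic_iff : ∀ {K : Type} [Field K] [CharZero K], BinaryRep (a : K) b (ε * (e * q : ℕ)) ↔
      ConicHasPoint ((-(a * b) : ℤ) : K) ((a * (ε * (e * q : ℕ)) : ℤ) : K) := by
    intro K _ _
    have h1 := binaryRep_iff_conicHasPoint (K := K) (s := ((ε * (e * q : ℕ) : ℤ) : K))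
      (Int.cast_ne_zero.2 ha) (Int.cast_ne_zero.2 hb) (Int.cast_ne_zero.2 hs0)
    push_cast at h1 ⊢
    exact h1
  rw [conic_iff]
  refine conicHasPoint_rat_of_local (neg_ne_zero.2 (mul_ne_zero ha hb)) (mul_ne_zero ha hs0)
    (fun p hpF => ?_) ?_
  · have hp := hpF.out
    have hpZ := Nat.prime_iff_prime_int.1 hp
    by_cases hpw : p ∣ w
    · rw [← conic_iff]
      have h1 := h.map (algebraMap ℚ ℚ_[p])
      refine BinaryRep.of_isSquare_div (s := (ε * (e * m : ℕ) : ℚ_[p])) (by simpa using h1) ?_ ?_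
      · exact mul_ne_zero (Int.cast_ne_zero.2 hε0) (Nat.cast_ne_zero.2 hem)
      · have : (ε : ℚ_[p]) ≠ 0 := Int.cast_ne_zero.2 hε0
        have : (e : ℚ_[p]) ≠ 0 := Nat.cast_ne_zero.2 he0
        have : (m : ℚ_[p]) ≠ 0 := Nat.cast_ne_zero.2 hm0
        have hqm : (ε * (e * q : ℕ) : ℚ_[p]) / (ε * (e * m : ℕ)) = q / m := by
          push_cast
          field_simp
        rw [hqm]
        exact hsq p hpw
    · have hpab : ¬ (p : ℤ) ∣ 2 * a * b := fun h => hpw (Int.natCast_dvd_natCast.1 (h.trans hw))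
      have hpa : ¬ (p : ℤ) ∣ a := fun h => hpab ((h.mul_left 2).mul_right b)
      have hpD : ¬ (p : ℤ) ∣ -(a * b) := fun h => hpab (by
        rw [dvd_neg] at h; rw [mul_assoc]; exact h.mul_left 2)
      have hp2 : p ≠ 2 := by
        rintro rfl
        exact hpab (by rw [mul_assoc]; exact dvd_mul_right _ _)
      by_cases hpq : p = q
      · subst hpq
        exact conicHasPoint_of_isSquare (Padic.isSquare_intCast_of_zmod hp2 hpD
          (ZMod.isSquare_of_jacobiSym_eq_one hJ)) _
      · refine Padic.conicHasPoint_of_units hp2 hpD fun hd => ?_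
        rcases hpZ.dvd_or_dvd hd with hd | hd
        · exact hpa hd
        have hd' : p ∣ e * q := by
          rw [← Int.natCast_dvd_natCast]
          rcases hε with rfl | rfl <;> simpa using hd
        rcases hp.dvd_mul.1 hd' with hd | hd
        · exact hpw (hd.trans hew)
        · exact hpq ((Nat.prime_dvd_prime_iff_eq hp hq).1 hd)
  · rw [← conic_iff]
    have hEQ : (0 : ℝ) < (e * q : ℕ) :=
      Nat.cast_pos.2 (Nat.pos_of_ne_zero (mul_ne_zero he0 hq.ne_zero))
    have hεε : (ε : ℝ) * ε = 1 := by rcases hε with rfl | rfl <;> norm_num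
    have key : ∀ c : ℤ, 0 < ε * c → (c : ℝ) * √((e * q : ℕ) / (ε * c)) ^ 2 = ε * (e * q : ℕ) := by
      intro c hc
      have hc' : (0 : ℝ) < ε * c := by exact_mod_cast hc
      have hc0 : (c : ℝ) ≠ 0 := right_ne_zero_of_mul hc'.ne'
      have he0 : (ε : ℝ) ≠ 0 := left_ne_zero_of_mul hc'.ne'
      rw [Real.sq_sqrt (div_pos hEQ hc').le]
      field_simp
      linear_combination -hεε
    rcases hpos with hpos | hpos
    · exact ⟨_, 0, by rw [key a hpos]; ring⟩
    · exact ⟨0, _, by rw [key b hpos]; ring⟩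

theorem Squarefree.gcd_eq_gcd_of_isSquare_padic {n₀ n₁ w : ℕ} (h0 : Squarefree n₀)
    (h1 : Squarefree n₁) (h : ∀ (p : ℕ) [Fact p.Prime], p ∈ w.primeFactors →
      IsSquare (n₀ * n₁ : ℚ_[p])) (hw : w ≠ 0) : n₀.gcd w = n₁.gcd w := by
  have aux : ∀ {n₀ n₁ p : ℕ}, p.Prime → Squarefree n₀ → (∀ [Fact p.Prime],
      IsSquare (n₀ * n₁ : ℚ_[p])) → p ∣ n₀ → p ∣ n₁ := by
    intro n₀ n₁ p hp h0 h hd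
    have := Fact.mk hp
    by_contra hnd
    obtain ⟨v, hv⟩ := @h this
    refine Padic.norm_sq_ne_inv v ?_
    have hn1 : ‖((n₁ : ℤ) : ℚ_[p])‖ = 1 := Padic.norm_intCast_eq_one (by exact_mod_cast hnd)
    have hn0 : ‖((n₀ : ℤ) : ℚ_[p])‖ = (p : ℝ)⁻¹ := Padic.norm_intCast_eq_inv
      (by exact_mod_cast hd) (fun hd2 => by
        have h3 : p * p ∣ n₀ := by rw [← pow_two]; exact_mod_cast hd2
        exact hp.one_lt.ne' (Nat.isUnit_iff.1 (h0 p h3)))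
    simp only [Int.cast_natCast] at hn0 hn1
    rw [← norm_pow, pow_two, ← hv, norm_mul, hn0, hn1, mul_one]
  have hs0 := h0.squarefree_of_dvd (Nat.gcd_dvd_left n₀ w)
  have hs1 := h1.squarefree_of_dvd (Nat.gcd_dvd_left n₁ w)
  rw [← Nat.prod_primeFactors_of_squarefree hs0, ← Nat.prod_primeFactors_of_squarefree hs1]
  congr 1
  ext p
  simp only [Nat.mem_primeFactors, hs0.ne_zero, hs1.ne_zero, Nat.dvd_gcd_iff, ne_eq,
    not_false_eq_true, and_true]
  refine and_congr_right fun hp => and_congr_left fun hpw => ⟨?_, ?_⟩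
  · exact aux hp h0 fun {_} => h p (Nat.mem_primeFactors.2 ⟨hp, hpw, hw⟩)
  · exact aux hp h1 fun {_} => by
      rw [mul_comm]; exact h p (Nat.mem_primeFactors.2 ⟨hp, hpw, hw⟩)

theorem Squarefree.coprime_div_gcd {n : ℕ} (h : Squarefree n) (w : ℕ) :
    (n / n.gcd w).Coprime w := by
  refine Nat.coprime_of_dvd fun p hp hpn hpw => ?_
  have hpg : p ∣ n.gcd w :=
    Nat.dvd_gcd (hpn.trans (Nat.div_dvd_of_dvd (Nat.gcd_dvd_left n w))) hpw
  have hpp := mul_dvd_mul hpg hpn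
  rw [Nat.mul_div_cancel' (Nat.gcd_dvd_left n w)] at hpp
  exact hp.one_lt.ne' (Nat.isUnit_iff.1 (h p hpp))

/-- The Hasse principle for quaternary forms: two binary forms with a common nonzero value at
every place have a common nonzero rational value. -/
theorem exists_common_binaryRep {a b c d : ℤ} (ha : a ≠ 0) (hb : b ≠ 0) (hc : c ≠ 0) (hd : d ≠ 0)
    {ε : ℤ} (hε : ε = 1 ∨ ε = -1) (hab : 0 < ε * a ∨ 0 < ε * b) (hcd : 0 < ε * c ∨ 0 < ε * d)
    (hloc : ∀ (p : ℕ) [Fact p.Prime], ∃ σ : ℚ_[p], σ ≠ 0 ∧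
      BinaryRep (a : ℚ_[p]) b σ ∧ BinaryRep (c : ℚ_[p]) d σ) :
    ∃ s : ℚ, s ≠ 0 ∧ BinaryRep (a : ℚ) b s ∧ BinaryRep (c : ℚ) d s := by
  choose σ hσ0 hσab hσcd using hloc
  set w : ℕ := (2 * a * b * (2 * c * d)).natAbs with hw
  have hw0 : w ≠ 0 := by simp [hw, ha, hb, hc, hd]
  have hwab : 2 * a * b ∣ (w : ℤ) := by rw [hw, Int.dvd_natAbs]; exact dvd_mul_right _ _
  have hwcd : 2 * c * d ∣ (w : ℤ) := by rw [hw, Int.dvd_natAbs]; exact dvd_mul_left _ _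
  obtain ⟨n₀, hn₀, hr₀, hs₀⟩ := exists_squarefree_binaryRep (w := w) hε hab σ
    fun p _ _ => ⟨hσ0 p, hσab p⟩
  obtain ⟨n₁, hn₁, hr₁, hs₁⟩ := exists_squarefree_binaryRep (w := w) hε hcd σ
    fun p _ _ => ⟨hσ0 p, hσcd p⟩
  have hε0 : ε ≠ 0 := by rcases hε with rfl | rfl <;> norm_num
  have hεε : ε * ε = 1 := by rcases hε with rfl | rfl <;> norm_num
  have hsq : ∀ (p : ℕ) [Fact p.Prime], p ∈ w.primeFactors → IsSquare (n₀ * n₁ : ℚ_[p]) := by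
    intro p _ hp
    have h1 := ((hs₀ p hp).mul (hs₁ p hp)).mul (⟨σ p, rfl⟩ : IsSquare (σ p * σ p))
    have := hσ0 p
    have hεp : (ε : ℚ_[p]) * ε = 1 := by exact_mod_cast congrArg (Int.cast : ℤ → ℚ_[p]) hεε
    have he : (n₀ * n₁ : ℚ_[p]) = ε * n₀ / σ p * (ε * n₁ / σ p) * (σ p * σ p) := by
      field_simp
      linear_combination -(n₀ * n₁ : ℚ_[p]) * hεp
    rw [he]
    exact h1
  have hgcd := hn₀.gcd_eq_gcd_of_isSquare_padic hn₁ hsq hw0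
  have hco₀ := hn₀.coprime_div_gcd w
  have hco₁ := hn₁.coprime_div_gcd w
  have hem₀ := Nat.mul_div_cancel' (Nat.gcd_dvd_left n₀ w)
  have hem₁ := Nat.mul_div_cancel' (Nat.gcd_dvd_left n₁ w)
  have hew := Nat.gcd_dvd_right n₀ w
  rw [← hgcd] at hco₁ hem₁
  set e := n₀.gcd w
  set m₀ := n₀ / e
  set m₁ := n₁ / e
  clear_value e m₀ m₁
  have hem₀' : e * m₀ ≠ 0 := hem₀ ▸ hn₀.ne_zero
  have hem₁' : e * m₁ ≠ 0 := hem₁ ▸ hn₁.ne_zero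
  obtain ⟨he0, hm₀0⟩ := mul_ne_zero_iff.1 hem₀'
  obtain ⟨-, hm₁0⟩ := mul_ne_zero_iff.1 hem₁'
  have h2w : 2 ∣ w := by
    rw [← Int.natCast_dvd_natCast]
    exact (show ((2 : ℕ) : ℤ) ∣ 2 * a * b by rw [mul_assoc]; exact dvd_mul_right _ _).trans hwab
  have hodd : ∀ {m : ℕ}, m.Coprime w → Odd m := fun hm =>
    Nat.coprime_two_right.1 (hm.coprime_dvd_right h2w)
  have hco8 : m₀.Coprime (8 * w) := by
    refine Nat.Coprime.mul_right ?_ hco₀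
    exact (hco₀.coprime_dvd_right h2w).pow_right 3
  obtain ⟨q, hqgt, hq, hqmod⟩ :=
    Nat.forall_exists_prime_gt_and_modEq w (mul_ne_zero (by norm_num : 8 ≠ 0) hw0) hco8
  have hqw : ¬ q ∣ w := fun h => absurd (Nat.le_of_dvd (Nat.pos_of_ne_zero hw0) h) (by omega)
  have hqodd : Odd q := hodd ((Nat.Prime.coprime_iff_not_dvd hq).2 hqw)
  have hsq₀ : ∀ (p : ℕ) [Fact p.Prime], p ∣ w → IsSquare (q / m₀ : ℚ_[p]) := by
    intro p hp hpw
    have hpm : ¬ p ∣ m₀ := fun h => hp.out.one_lt.ne' (Nat.eq_one_of_dvd_coprimes hco₀ h hpw)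
    have hm1 : ‖((m₀ : ℤ) : ℚ_[p])‖ = 1 := Padic.norm_intCast_eq_one (by exact_mod_cast hpm)
    rw [Int.cast_natCast] at hm1
    refine Padic.isSquare_div_of_norm_sub_lt (Nat.cast_ne_zero.2 hm₀0) ?_
    rw [hm1, mul_one]
    obtain ⟨k, hk⟩ : ((8 * w : ℕ) : ℤ) ∣ q - m₀ := Nat.modEq_iff_dvd.1 hqmod.symm
    have hk' : (q : ℚ_[p]) - m₀ = 4 * ((2 * w * k : ℤ) : ℚ_[p]) := by
      have := congrArg (Int.cast : ℤ → ℚ_[p]) hk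
      push_cast at this ⊢
      rw [this]; ring
    rw [hk', norm_mul]
    have h4 : 0 < ‖(4 : ℚ_[p])‖ := norm_pos_iff.2 (by norm_num)
    have : ‖((2 * w * k : ℤ) : ℚ_[p])‖ < 1 := Padic.norm_intCast_lt_one_iff.2
      (((Int.natCast_dvd_natCast.2 hpw).mul_left 2).mul_right k)
    nlinarith
  have hmm : ∀ (p : ℕ) [Fact p.Prime], p ∣ w → IsSquare ((m₀ * m₁ : ℕ) : ℚ_[p]) := by
    intro p hp hpw
    have he : (e : ℚ_[p]) ≠ 0 := Nat.cast_ne_zero.2 he0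
    have h1 := (hsq p (Nat.mem_primeFactors.2 ⟨hp.out, hpw, hw0⟩)).mul
      (⟨(e : ℚ_[p])⁻¹, rfl⟩ : IsSquare ((e : ℚ_[p])⁻¹ * (e : ℚ_[p])⁻¹))
    have he' : ((m₀ * m₁ : ℕ) : ℚ_[p]) = n₀ * n₁ * ((e : ℚ_[p])⁻¹ * (e : ℚ_[p])⁻¹) := by
      rw [← hem₀, ← hem₁]
      push_cast
      field_simp
    rw [he']
    exact h1
  have hsq₁ : ∀ (p : ℕ) [Fact p.Prime], p ∣ w → IsSquare (q / m₁ : ℚ_[p]) := by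
    intro p hp hpw
    have hm : (m₁ : ℚ_[p]) ≠ 0 := Nat.cast_ne_zero.2 hm₁0
    have hm' : (m₀ : ℚ_[p]) ≠ 0 := Nat.cast_ne_zero.2 hm₀0
    have h1 := ((hsq₀ p hpw).mul (hmm p hpw)).mul
      (⟨(m₁ : ℚ_[p])⁻¹, rfl⟩ : IsSquare ((m₁ : ℚ_[p])⁻¹ * (m₁ : ℚ_[p])⁻¹))
    have he' : (q / m₁ : ℚ_[p]) =
        q / m₀ * ((m₀ * m₁ : ℕ) : ℚ_[p]) * ((m₁ : ℚ_[p])⁻¹ * (m₁ : ℚ_[p])⁻¹) := by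
      push_cast
      field_simp
    rw [he']
    exact h1
  have hdvd : ∀ {x y : ℤ}, 2 * x * y ∣ (w : ℤ) → 2 * (-(x * y)).natAbs ∣ w := by
    intro x y h
    have := Int.natAbs_dvd_natAbs.2 h
    rw [mul_assoc, Int.natAbs_mul] at this
    simpa using this
  have hdvd' : ∀ {x y : ℤ}, 2 * x * y ∣ (w : ℤ) → 4 * (-(x * y)).natAbs ∣ 8 * w := fun h => by
    obtain ⟨k, hk⟩ := hdvd h
    exact ⟨4 * k, by rw [hk]; ring⟩
  have hJ₀ : jacobiSym (-(a * b)) q = 1 := by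
    rw [jacobiSym_congr_right hqodd (hodd hco₀) (hdvd' hwab) hqmod]
    exact jacobiSym_eq_one_of_binaryRep ha hb hε hn₀ ⟨e, by rw [← hem₀]; ring⟩ hwab hco₀ hr₀
  have hJ₁ : jacobiSym (-(c * d)) q = 1 := by
    have h1 := jacobiSym_eq_one_of_binaryRep hc hd hε hn₁ ⟨e, by rw [← hem₁]; ring⟩ hwcd hco₁ hr₁
    have h2 := jacobiSym_eq_one_of_isSquare_padic (D := -(c * d)) (M := m₀ * m₁)
      (neg_ne_zero.2 (mul_ne_zero hc hd))
      ((hco₀.mul_left hco₁).coprime_dvd_right (hdvd hwcd))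
      (fun p _ hp => hmm p (hp.trans (hdvd hwcd)))
    rw [jacobiSym.mul_right' _ hm₀0 hm₁0, h1, mul_one] at h2
    rw [jacobiSym_congr_right hqodd (hodd hco₀) (hdvd' hwcd) hqmod, h2]
  refine ⟨ε * (e * q : ℕ), ?_, ?_, ?_⟩
  · exact mul_ne_zero (Int.cast_ne_zero.2 hε0) (Nat.cast_ne_zero.2 (mul_ne_zero he0 hq.ne_zero))
  · exact binaryRep_prime_of_binaryRep ha hb hε hab hem₀' hwab hew hq hqw hsq₀ hJ₀
      (by rwa [hem₀])
  · exact binaryRep_prime_of_binaryRep hc hd hε hcd hem₁' hwcd hew hq hqw hsq₁ hJ₁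
      (by rwa [hem₁])

end Quaternary

section Quinary

/-- The diagonal quadratic form with coefficients `c` has a nontrivial zero. -/
def DiagIsotropic {ι K : Type*} [Fintype ι] [Field K] (c : ι → K) : Prop :=
  ∃ x : ι → K, x ≠ 0 ∧ ∑ i, c i * x i ^ 2 = 0

theorem DiagIsotropic.of_injective {ι κ K : Type*} [Fintype ι] [Fintype κ] [Field K]
    {c : κ → K} {f : ι → κ} (hf : f.Injective) (h : DiagIsotropic (c ∘ f)) : DiagIsotropic c := by
  classical
  obtain ⟨x, hx, h0⟩ := h
  refine ⟨Function.extend f x 0, fun he => hx ?_, ?_⟩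
  · ext i
    rw [← hf.extend_apply x 0 i, he, Pi.zero_apply, Pi.zero_apply]
  · rw [← h0, ← Finset.sum_subset (Finset.subset_univ (Finset.univ.image f)),
      Finset.sum_image hf.injOn]
    · simp [hf.extend_apply]
    · intro k _ hk
      rw [Function.extend_apply' _ _ _ fun ⟨i, hi⟩ =>
        hk (Finset.mem_image.2 ⟨i, Finset.mem_univ i, hi⟩)]
      simp

theorem DiagIsotropic.of_mul_sq {ι K : Type*} [Fintype ι] [Field K] {c c' r : ι → K} {l : K}
    (hr : ∀ i, r i ≠ 0) (hc : ∀ i, l * c' i = c i * r i ^ 2)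
    (h : DiagIsotropic c') : DiagIsotropic c := by
  obtain ⟨x, hx, h0⟩ := h
  refine ⟨fun i => r i * x i, fun he => hx ?_, ?_⟩
  · ext i
    exact (mul_eq_zero.1 (congrFun he i)).resolve_left (hr i)
  · rw [← mul_zero l, ← h0, Finset.mul_sum]
    refine Finset.sum_congr rfl fun i _ => ?_
    linear_combination -x i ^ 2 * hc i

theorem Padic.diagIsotropic_of_units {p : ℕ} [hp : Fact p.Prime] (h2 : p ≠ 2) {c : Fin 3 → ℤ}
    (hc : ∀ i, ¬ (p : ℤ) ∣ c i) : DiagIsotropic fun i => (c i : ℚ_[p]) := by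
  have hpZ := Nat.prime_iff_prime_int.1 hp.out
  have hd : ∀ i j, ¬ (p : ℤ) ∣ -(c i * c j) := fun i j h =>
    (hpZ.dvd_or_dvd ((dvd_neg).1 h)).elim (hc i) (hc j)
  have h0 : (c 0 : ℚ_[p]) ≠ 0 := Int.cast_ne_zero.2 fun h => hc 0 (h ▸ dvd_zero _)
  obtain ⟨x, y, z, hne, h⟩ := Padic.conicHasPoint_of_units h2 (hd 0 1) (hd 0 2)
  refine ⟨![x / c 0, y, z], fun he => ?_, ?_⟩
  · have e0 := congrFun he 0
    have e1 := congrFun he 1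
    have e2 := congrFun he 2
    simp [h0] at e0 e1 e2
    simp [e0, e1, e2] at hne
  · simp only [Fin.sum_univ_three, Matrix.cons_val]
    push_cast at h
    field_simp
    linear_combination h

theorem ZMod.exists_quinary_zero_eight : ∀ a : ZMod 8, a * a = 1 → ∀ b : ZMod 8, b * b = 1 →
    ∀ c : ZMod 8, 2 * c ≠ 0 → ∀ d : ZMod 8, 2 * d ≠ 0 → ∃ x y z w : Fin 3,
      1 + a * (x : ℕ) ^ 2 + b * (y : ℕ) ^ 2 + c * (z : ℕ) ^ 2 + d * (w : ℕ) ^ 2 = 0 := by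
  decide +kernel

theorem Padic.diagIsotropic_two {c : Fin 5 → ℤ} (h0 : ¬ 2 ∣ c 0) (h1 : ¬ 2 ∣ c 1)
    (h2 : ¬ 2 ∣ c 2) (h3 : ¬ 4 ∣ c 3) (h4 : ¬ 4 ∣ c 4) :
    DiagIsotropic fun i => (c i : ℚ_[2]) := by
  have hodd : ∀ n : ℤ, ¬ 2 ∣ n → (n : ZMod 8) * n = 1 := by
    intro n hn
    rw [← Int.cast_mul, ← Int.cast_one, ZMod.intCast_eq_intCast_iff_dvd_sub]
    have : n % 8 = 1 ∨ n % 8 = 3 ∨ n % 8 = 5 ∨ n % 8 = 7 := by omega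
    have key : (1 - n * n) % 8 = 0 := by
      rcases this with h | h | h | h <;> simp [Int.sub_emod, Int.mul_emod, h]
    exact Int.dvd_of_emod_eq_zero key
  have heven : ∀ n : ℤ, ¬ 4 ∣ n → 2 * ((c 0 : ZMod 8) * n) ≠ 0 := by
    intro n hn he
    have h5 : (2 : ZMod 8) * n = ((2 * n : ℤ) : ZMod 8) := by push_cast; ring
    have h6 : (2 : ZMod 8) * n = 0 := by
      linear_combination (c 0 : ZMod 8) * he - 2 * (n : ZMod 8) * hodd _ h0
    rw [h5, ZMod.intCast_zmod_eq_zero_iff_dvd] at h6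
    exact hn (by push_cast at h6; omega)
  obtain ⟨x, y, z, w, h⟩ := ZMod.exists_quinary_zero_eight
    (c 0 * c 1) (by linear_combination (c 0 * c 0 : ZMod 8) * hodd _ h1 + hodd _ h0)
    (c 0 * c 2) (by linear_combination (c 0 * c 0 : ZMod 8) * hodd _ h2 + hodd _ h0)
    (c 0 * c 3) (heven _ h3) (c 0 * c 4) (heven _ h4)
  set N : ℤ := c 0 * c 1 * (x : ℕ) ^ 2 + c 0 * c 2 * (y : ℕ) ^ 2 + c 0 * c 3 * (z : ℕ) ^ 2 +
    c 0 * c 4 * (w : ℕ) ^ 2 with hN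
  have h8 : (8 : ℤ) ∣ 1 + N := by
    have : ((1 + N : ℤ) : ZMod 8) = 0 := by
      rw [hN]; push_cast; rw [← h]; ring
    exact_mod_cast (ZMod.intCast_zmod_eq_zero_iff_dvd _ _).1 this
  obtain ⟨k, hk⟩ := h8
  have hlt : ‖((-N : ℤ) : ℚ_[2]) - 1‖ < ‖(4 : ℚ_[2])‖ := by
    have he : ((-N : ℤ) : ℚ_[2]) - 1 = 4 * ((2 * -k : ℤ) : ℚ_[2]) := by
      have := congrArg (Int.cast : ℤ → ℚ_[2]) hk
      push_cast at this ⊢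
      linear_combination -this
    have h4 : 0 < ‖(4 : ℚ_[2])‖ := norm_pos_iff.2 (by norm_num)
    have h5 : ‖((2 * -k : ℤ) : ℚ_[2])‖ < 1 :=
      Padic.norm_intCast_lt_one_iff.2 (by exact_mod_cast dvd_mul_right 2 (-k))
    rw [he, norm_mul]
    nlinarith
  obtain ⟨v, hv⟩ := Padic.isSquare_of_norm_sub_one_lt hlt
  have hN0 : N ≠ 0 := by omega
  have hv0 : v ≠ 0 := by
    rintro rfl
    exact neg_ne_zero.2 hN0 (by exact_mod_cast hv.trans (mul_zero _))
  have hc0 : (c 0 : ℚ_[2]) ≠ 0 := Int.cast_ne_zero.2 fun h => h0 (h ▸ dvd_zero _)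
  refine ⟨![v / c 0, x.val, y.val, z.val, w.val], fun he => ?_, ?_⟩
  · have e0 := congrFun he 0
    simp [hc0, hv0] at e0
  · rw [hN] at hv
    push_cast at hv
    simp only [Fin.sum_univ_five, Matrix.cons_val]
    field_simp
    linear_combination -hv

theorem Padic.diagIsotropic_of_three_units {p : ℕ} [hp : Fact p.Prime] {c : Fin 5 → ℤ}
    (hc : ∀ i, ¬ (p : ℤ) ^ 2 ∣ c i) {i j k : Fin 5} (hij : i ≠ j) (hik : i ≠ k) (hjk : j ≠ k)
    (hi : ¬ (p : ℤ) ∣ c i) (hj : ¬ (p : ℤ) ∣ c j) (hk : ¬ (p : ℤ) ∣ c k) :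
    DiagIsotropic fun i => (c i : ℚ_[p]) := by
  by_cases h2 : p = 2
  · subst h2
    obtain ⟨l, m, hf⟩ : ∃ l m, Function.Injective ![i, j, k, l, m] := by
      clear hi hj hk
      revert i j k
      decide
    exact .of_injective hf (Padic.diagIsotropic_two (c := c ∘ ![i, j, k, l, m])
      hi hj hk (hc l) (hc m))
  · have hf : Function.Injective ![i, j, k] := by
      clear hi hj hk
      revert i j k
      decide
    refine .of_injective hf (Padic.diagIsotropic_of_units h2 (c := c ∘ ![i, j, k]) ?_)
    intro t
    fin_cases t
    exacts [hi, hj, hk]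

/-- Quinary diagonal forms are isotropic over `ℚ_[p]`; the coefficients may be taken squarefree. -/
theorem Padic.diagIsotropic_of_not_sq_dvd {p : ℕ} [hp : Fact p.Prime] {c : Fin 5 → ℤ}
    (hc : ∀ i, ¬ (p : ℤ) ^ 2 ∣ c i) : DiagIsotropic fun i => (c i : ℚ_[p]) := by
  classical
  have hpZ := Nat.prime_iff_prime_int.1 hp.out
  have hcard := Finset.card_filter_add_card_filter_not (s := (Finset.univ : Finset (Fin 5)))
    (fun i => (p : ℤ) ∣ c i)
  rw [Finset.card_univ, Fintype.card_fin] at hcard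
  rcases Nat.lt_or_ge 2 (Finset.univ.filter fun i => ¬ (p : ℤ) ∣ c i).card with h | h
  · obtain ⟨i, hi, j, hj, k, hk, hij, hik, hjk⟩ := Finset.two_lt_card.1 h
    simp only [Finset.mem_filter, Finset.mem_univ, true_and] at hi hj hk
    exact Padic.diagIsotropic_of_three_units hc hij hik hjk hi hj hk
  · obtain ⟨i, hi, j, hj, k, hk, hij, hik, hjk⟩ := Finset.two_lt_card.1
      (show 2 < (Finset.univ.filter fun i => (p : ℤ) ∣ c i).card by omega)
    simp only [Finset.mem_filter, Finset.mem_univ, true_and] at hi hj hk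
    have hp0 : (p : ℤ) ≠ 0 := hpZ.ne_zero
    have hpp : (p : ℚ_[p]) ≠ 0 := Nat.cast_ne_zero.2 hp.out.ne_zero
    have hdiv : ∀ n : ℤ, ¬ (p : ℤ) ^ 2 ∣ n → (p : ℤ) ∣ n → ¬ (p : ℤ) ∣ n / p := by
      rintro n hn ⟨m, rfl⟩ h
      rw [Int.mul_ediv_cancel_left _ hp0] at h
      exact hn (by rw [pow_two]; exact mul_dvd_mul_left _ h)
    let c' : Fin 5 → ℤ := fun i => if (p : ℤ) ∣ c i then c i / p else p * c i
    have hc' : ∀ {i}, (p : ℤ) ∣ c i → ¬ (p : ℤ) ∣ c' i := fun {i} hi => by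
      simp only [c', if_pos hi]
      exact hdiv _ (hc i) hi
    refine .of_mul_sq (l := p) (r := fun i => if (p : ℤ) ∣ c i then 1 else p)
      (c' := fun i => (c' i : ℚ_[p])) (fun i => ?_) (fun i => ?_)
      (Padic.diagIsotropic_of_three_units (fun i => ?_) hij hik hjk (hc' hi) (hc' hj) (hc' hk))
    · split_ifs
      exacts [one_ne_zero, hpp]
    · by_cases hd : (p : ℤ) ∣ c i
      · simp only [c', if_pos hd]
        obtain ⟨m, hm⟩ := hd
        rw [hm, Int.mul_ediv_cancel_left _ hp0]
        push_cast
        ring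
      · simp only [c', if_neg hd]
        push_cast
        ring
    · by_cases hd : (p : ℤ) ∣ c i
      · exact fun h => hc' hd ((dvd_pow_self _ two_ne_zero).trans h)
      · simp only [c', if_neg hd]
        intro h
        rw [pow_two] at h
        exact hd (Int.dvd_of_mul_dvd_mul_left hp0 h)

theorem BinaryRep.self_left {K : Type*} [Field K] (a b : K) : BinaryRep a b a := ⟨1, 0, by ring⟩

variable {K : Type*} [Field K] [CharZero K]

theorem exists_common_binaryRep_of_zero {c d e f z w v t : K} (hc : c ≠ 0) (hd : d ≠ 0)
    (he : e ≠ 0) (hf : f ≠ 0) (hne : z ≠ 0 ∨ w ≠ 0 ∨ v ≠ 0 ∨ t ≠ 0)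
    (h : c * z ^ 2 + d * w ^ 2 + e * v ^ 2 + f * t ^ 2 = 0) :
    ∃ σ : K, σ ≠ 0 ∧ BinaryRep c d σ ∧ BinaryRep (-e) (-f) σ := by
  by_cases h0 : c * z ^ 2 + d * w ^ 2 = 0
  · by_cases hzw : z ≠ 0 ∨ w ≠ 0
    · exact ⟨-e, neg_ne_zero.2 he, .of_isotropic hc hd hzw h0 _, .self_left _ _⟩
    · have hvt : v ≠ 0 ∨ t ≠ 0 := by tauto
      exact ⟨c, hc, .self_left _ _, .of_isotropic (neg_ne_zero.2 he) (neg_ne_zero.2 hf) hvt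
        (by linear_combination h0 - h) _⟩
  · exact ⟨_, h0, ⟨z, w, rfl⟩, v, t, by linear_combination -h⟩

theorem DiagIsotropic.exists_binaryRep {c : Fin 5 → K} (hc : ∀ i, c i ≠ 0)
    (h : DiagIsotropic c) : ∃ τ σ : K, τ ≠ 0 ∧ σ ≠ 0 ∧ BinaryRep (c 0) (c 1) τ ∧
      BinaryRep (c 2) (c 3) σ ∧ BinaryRep (-c 4) (-τ) σ := by
  obtain ⟨x, hx, h⟩ := h
  rw [Fin.sum_univ_five] at h
  obtain ⟨τ, t, hτ, hr, hne, h'⟩ : ∃ τ t : K, τ ≠ 0 ∧ BinaryRep (c 0) (c 1) τ ∧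
      ∃ z w v, (z ≠ 0 ∨ w ≠ 0 ∨ v ≠ 0 ∨ t ≠ 0) ∧
        c 2 * z ^ 2 + c 3 * w ^ 2 + c 4 * v ^ 2 + τ * t ^ 2 = 0 := by
    by_cases h0 : c 0 * x 0 ^ 2 + c 1 * x 1 ^ 2 = 0
    · by_cases hxy : x 0 ≠ 0 ∨ x 1 ≠ 0
      · exact ⟨-c 2, 1, neg_ne_zero.2 (hc 2), .of_isotropic (hc 0) (hc 1) hxy h0 _, 1, 0, 0,
          .inl one_ne_zero, by ring⟩
      · refine ⟨c 0, 0, hc 0, .self_left _ _, x 2, x 3, x 4, ?_, by linear_combination h - h0⟩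
        by_contra hcon
        push Not at hxy hcon
        refine hx (funext fun i => ?_)
        fin_cases i
        exacts [hxy.1, hxy.2, hcon.1, hcon.2.1, hcon.2.2.1]
    · exact ⟨_, 1, h0, ⟨_, _, rfl⟩, x 2, x 3, x 4, .inr (.inr (.inr one_ne_zero)),
        by linear_combination h⟩
  obtain ⟨w, v, hne, h'⟩ := h'
  obtain ⟨σ, hσ, h1, h2⟩ := exists_common_binaryRep_of_zero (hc 2) (hc 3) (hc 4) hτ hne h'
  exact ⟨τ, σ, hτ, hσ, hr, h1, h2⟩

end Quinary

section Meyer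

theorem diagIsotropic_rat_of_squarefree {c : Fin 5 → ℤ} (hc : ∀ i, Squarefree (c i))
    (h0 : 0 < c 0) (h4 : c 4 < 0) : DiagIsotropic fun i => (c i : ℚ) := by
  have hne : ∀ i, c i ≠ 0 := fun i => (hc i).ne_zero
  have hloc : ∀ (p : ℕ) [Fact p.Prime], ∃ τ σ : ℚ_[p], τ ≠ 0 ∧ σ ≠ 0 ∧
      BinaryRep (c 0 : ℚ_[p]) (c 1) τ ∧ BinaryRep (c 2 : ℚ_[p]) (c 3) σ ∧
      BinaryRep (-c 4 : ℚ_[p]) (-τ) σ := by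
    intro p hp
    refine DiagIsotropic.exists_binaryRep (c := fun i => (c i : ℚ_[p]))
      (fun i => Int.cast_ne_zero.2 (hne i)) (Padic.diagIsotropic_of_not_sq_dvd fun i hd => ?_)
    rw [pow_two] at hd
    exact (Nat.prime_iff_prime_int.1 hp.out).not_isUnit (hc i p hd)
  choose τ σ hτ hσ hab hcd het using hloc
  set w : ℕ := (2 * c 2 * c 3 * c 4).natAbs with hw
  have hw0 : w ≠ 0 := by simp [hw, hne]
  obtain ⟨x, y, ht, hsq⟩ := exists_int_binary_value (w := w) (ε := 1) (b := c 1)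
    (.inl (by simpa using h0)) τ fun p _ _ => ⟨hτ p, hab p⟩
  set t : ℤ := c 0 * x ^ 2 + c 1 * y ^ 2 with ht_def
  rw [one_mul] at ht
  obtain ⟨ε, hε, hεc⟩ : ∃ ε : ℤ, (ε = 1 ∨ ε = -1) ∧ 0 < ε * c 2 := by
    rcases (hne 2).lt_or_gt with h | h
    · exact ⟨-1, .inr rfl, by omega⟩
    · exact ⟨1, .inl rfl, by omega⟩
  obtain ⟨s, hs, ⟨z, w', hzw⟩, v, u, hvu⟩ := exists_common_binaryRep (hne 2) (hne 3)
    (neg_ne_zero.2 (hne 4)) (neg_ne_zero.2 ht.ne') hε (.inl hεc)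
    (by rcases hε with rfl | rfl
        · left; omega
        · right; omega) fun p hp => by
    by_cases hpw : p ∣ w
    · obtain ⟨r, hr⟩ := hsq p (Nat.mem_primeFactors.2 ⟨hp.out, hpw, hw0⟩)
      have htp : (t : ℚ_[p]) ≠ 0 := Int.cast_ne_zero.2 ht.ne'
      have hr0 : r ≠ 0 := by
        rintro rfl
        rw [mul_zero] at hr
        exact div_ne_zero htp (hτ p) hr
      rw [div_eq_iff (hτ p)] at hr
      obtain ⟨X, Y, hXY⟩ := het p
      refine ⟨σ p, hσ p, hcd p, X, Y / r, ?_⟩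
      rw [← hXY]
      push_cast
      rw [hr]
      field_simp
    · have hpZ := Nat.prime_iff_prime_int.1 hp.out
      have hpd : ¬ (p : ℤ) ∣ 2 * c 2 * c 3 * c 4 := fun h =>
        hpw (Int.natCast_dvd_natCast.1 (by rwa [hw, Int.dvd_natAbs]))
      simp only [hpZ.dvd_mul, not_or] at hpd
      obtain ⟨⟨⟨hp2, hp2c⟩, hp3⟩, hp4⟩ := hpd
      have h2 : p ≠ 2 := by rintro rfl; exact hp2 dvd_rfl
      have hc4 : (-c 4 : ℚ_[p]) ≠ 0 := neg_ne_zero.2 (Int.cast_ne_zero.2 (hne 4))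
      refine ⟨-c 4, hc4, ?_, by push_cast; exact .self_left _ _⟩
      rw [binaryRep_iff_conicHasPoint (Int.cast_ne_zero.2 (hne 2)) (Int.cast_ne_zero.2 (hne 3)) hc4]
      have := Padic.conicHasPoint_of_units h2 (A := -(c 2 * c 3)) (B := c 2 * -c 4)
        (by simp [hpZ.dvd_mul, hp2c, hp3]) (by simp [hpZ.dvd_mul, hp2c, hp4])
      simpa using this
  refine ⟨![x * u, y * u, z, w', v], fun he => hs ?_, ?_⟩
  · have e2 := congrFun he 2
    have e3 := congrFun he 3
    simp only [Matrix.cons_val, Pi.zero_apply] at e2 e3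
    rw [← hzw, e2, e3]
    ring
  · simp only [Fin.sum_univ_five, Matrix.cons_val]
    rw [ht_def] at hvu
    push_cast at hvu
    linear_combination hzw - hvu

theorem Rat.exists_squarefree_mul_sq {q : ℚ} (hq : q ≠ 0) :
    ∃ (s : ℤ) (r : ℚ), Squarefree s ∧ r ≠ 0 ∧ q = s * r ^ 2 := by
  obtain ⟨a, b, hab, ha⟩ := Nat.sq_mul_squarefree (q.num * q.den).natAbs
  have hd : (q.den : ℚ) ≠ 0 := Nat.cast_ne_zero.2 q.den_ne_zero
  have hn : q.num * q.den ≠ 0 :=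
    mul_ne_zero (Rat.num_ne_zero.2 hq) (Nat.cast_ne_zero.2 q.den_ne_zero)
  have hb : (b : ℚ) ≠ 0 := by
    rw [Nat.cast_ne_zero]
    rintro rfl
    simp at hab
    exact hn (mul_eq_zero.2 (by simpa using hab.symm))
  have hqn : q = (q.num * q.den : ℤ) / (q.den : ℚ) ^ 2 := by
    push_cast
    nth_rewrite 1 [← Rat.num_div_den q]
    field_simp
  have hsq : ∃ s : ℤ, Squarefree s ∧ q.num * q.den = b ^ 2 * s := by
    rcases Int.natAbs_eq (q.num * q.den) with h | h
    · exact ⟨a, Int.squarefree_natCast.2 ha, by rw [h, ← hab]; push_cast; ring⟩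
    · refine ⟨-a, ?_, by rw [h, ← hab]; push_cast; ring⟩
      rw [← Int.squarefree_natAbs]
      simpa using ha
  obtain ⟨s, hs, h⟩ := hsq
  refine ⟨s, b / q.den, hs, div_ne_zero hb hd, ?_⟩
  refine hqn.trans ?_
  rw [h]
  push_cast
  field_simp

theorem diagIsotropic_rat {c : Fin 5 → ℚ} (hc : ∀ i, c i ≠ 0) (h0 : 0 < c 0) (h4 : c 4 < 0) :
    DiagIsotropic c := by
  choose s r hs hr hcs using fun i => Rat.exists_squarefree_mul_sq (hc i)
  refine .of_mul_sq (c' := fun i => (s i : ℚ)) (l := 1) (r := fun i => (r i)⁻¹)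
    (fun i => inv_ne_zero (hr i)) (fun i => ?_) (diagIsotropic_rat_of_squarefree hs ?_ ?_)
  · rw [hcs i]
    have := hr i
    field_simp
  · rw [hcs 0] at h0
    exact_mod_cast pos_of_mul_pos_left h0 (sq_nonneg _)
  · rw [hcs 4] at h4
    by_contra hcon
    push Not at hcon
    have : (0 : ℚ) ≤ s 4 := by exact_mod_cast hcon
    nlinarith [mul_nonneg this (sq_nonneg (r 4))]

end Meyer

section Lattice

theorem exists_injective_apply_eq {m n : ℕ} (hmn : m ≤ n) {a b : Fin m} (hab : a ≠ b)
    {i j : Fin n} (hij : i ≠ j) : ∃ f : Fin m → Fin n, f.Injective ∧ f a = i ∧ f b = j := by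
  let s := Equiv.swap (Fin.castLE hmn a) i
  have hs : s (Fin.castLE hmn a) = i := Equiv.swap_apply_left _ _
  have hi : i ≠ s (Fin.castLE hmn b) := by
    rw [← hs, s.injective.ne_iff, (Fin.castLE_injective hmn).ne_iff]
    exact hab
  refine ⟨fun k => Equiv.swap (s (Fin.castLE hmn b)) j (s (Fin.castLE hmn k)),
    (Equiv.injective _).comp (s.injective.comp (Fin.castLE_injective hmn)), ?_, ?_⟩
  · simp only [hs]
    exact Equiv.swap_apply_of_ne_of_ne hi hij
  · exact Equiv.swap_apply_left _ _

theorem LinearMap.BilinForm.apply_sum_smul_self_of_isOrthoᵢ {ι K V : Type*} [Fintype ι] [Field K]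
    [AddCommGroup V] [Module K V] {B : LinearMap.BilinForm K V} {v : ι → V} (hv : B.IsOrthoᵢ v)
    (x : ι → K) : B (∑ i, x i • v i) (∑ i, x i • v i) = ∑ i, B (v i) (v i) * x i ^ 2 := by
  classical
  simp only [map_sum, map_smul, LinearMap.sum_apply, LinearMap.smul_apply, smul_eq_mul]
  refine Finset.sum_congr rfl fun i _ => ?_
  rw [Finset.sum_eq_single i]
  · ring
  · intro j _ hji
    have : B (v j) (v i) = 0 := hv hji
    rw [this, mul_zero]
  · simp

theorem LinearMap.BilinForm.exists_isotropic_rat {V : Type*} [AddCommGroup V] [Module ℚ V]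
    [FiniteDimensional ℚ V] {B : LinearMap.BilinForm ℚ V} (hB : LinearMap.IsSymm B)
    (hnd : ∀ x, (∀ y, B x y = 0) → x = 0) (hpos : ∃ x, 0 < B x x) (hneg : ∃ x, B x x < 0)
    (hrank : 5 ≤ Module.finrank ℚ V) : ∃ x, x ≠ 0 ∧ B x x = 0 := by
  have : Invertible (2 : ℚ) := invertibleOfNonzero two_ne_zero
  obtain ⟨v, hv⟩ := LinearMap.BilinForm.exists_orthogonal_basis hB
  have hsum := apply_sum_smul_self_of_isOrthoᵢ hv
  have hne : ∀ i, B (v i) (v i) ≠ 0 := by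
    refine fun i hi => v.ne_zero i (hnd _ fun y => ?_)
    rw [← v.sum_repr y, map_sum]
    refine Finset.sum_eq_zero fun j _ => ?_
    rw [map_smul]
    rcases eq_or_ne i j with rfl | hij
    · rw [hi, smul_zero]
    · have : B (v i) (v j) = 0 := hv hij
      rw [this, smul_zero]
  obtain ⟨i, hi⟩ : ∃ i, 0 < B (v i) (v i) := by
    by_contra! hcon
    obtain ⟨x, hx⟩ := hpos
    rw [← v.sum_repr x, hsum] at hx
    exact hx.not_ge (Finset.sum_nonpos fun i _ =>
      mul_nonpos_of_nonpos_of_nonneg (hcon i) (sq_nonneg _))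
  obtain ⟨j, hj⟩ : ∃ j, B (v j) (v j) < 0 := by
    by_contra! hcon
    obtain ⟨x, hx⟩ := hneg
    rw [← v.sum_repr x, hsum] at hx
    exact hx.not_ge (Finset.sum_nonneg fun i _ => mul_nonneg (hcon i) (sq_nonneg _))
  have hij : i ≠ j := by
    rintro rfl
    exact hi.not_gt hj
  obtain ⟨f, hf, hfi, hfj⟩ := exists_injective_apply_eq hrank
    (show (0 : Fin 5) ≠ 4 by decide) hij
  obtain ⟨x, hx, h0⟩ := DiagIsotropic.of_injective (c := fun i => B (v i) (v i)) hf
    (diagIsotropic_rat (fun i => hne _) (by simpa [hfi] using hi) (by simpa [hfj] using hj))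
  refine ⟨∑ i, x i • v i, fun h => hx ?_, (hsum x).trans h0⟩
  exact funext fun i => Fintype.linearIndependent_iff.1 v.linearIndependent x h i

end Lattice

section BaseChange

open scoped TensorProduct nonZeroDivisors

variable {R M : Type*} (K : Type*) [CommRing R] [Field K] [Algebra R K] [AddCommGroup M]
  [Module R M]

theorem LinearMap.BilinForm.baseChange_one_tmul (B : LinearMap.BilinForm R M) (x y : M) :
    B.baseChange K (1 ⊗ₜ x) (1 ⊗ₜ y) = algebraMap R K (B x y) := by
  rw [baseChange_tmul, mul_one, Algebra.algebraMap_eq_smul_one]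

variable [IsDomain R] [IsFractionRing R K]

theorem TensorProduct.exists_smul_eq_one_tmul (v : K ⊗[R] M) :
    ∃ (r : K) (x : M), r ≠ 0 ∧ r • v = 1 ⊗ₜ x := by
  obtain ⟨⟨x, r⟩, h⟩ := IsLocalizedModule.surj R⁰ (TensorProduct.mk R K M 1) v
  refine ⟨algebraMap R K r, x, IsFractionRing.to_map_ne_zero_of_mem_nonZeroDivisors r.2, ?_⟩
  rw [algebraMap_smul]
  exact h

theorem LinearMap.BilinForm.eq_zero_of_baseChange_eq_zero {B : LinearMap.BilinForm R M}
    (hB : ∀ x, (∀ y, B x y = 0) → x = 0) {v : K ⊗[R] M}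
    (hv : ∀ y, B.baseChange K v y = 0) : v = 0 := by
  obtain ⟨r, x, hr, hx⟩ := TensorProduct.exists_smul_eq_one_tmul K v
  have hx0 : x = 0 := hB x fun y => FaithfulSMul.algebraMap_injective R K <| by
    rw [← baseChange_one_tmul, ← hx, map_smul, LinearMap.smul_apply, hv, smul_zero, map_zero]
  rw [hx0, TensorProduct.tmul_zero] at hx
  exact (smul_eq_zero.1 hx).resolve_left hr

theorem LinearMap.BilinForm.exists_isotropic_of_baseChange {B : LinearMap.BilinForm R M}
    (h : ∃ v : K ⊗[R] M, v ≠ 0 ∧ B.baseChange K v v = 0) : ∃ x, x ≠ 0 ∧ B x x = 0 := by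
  obtain ⟨v, hv, hv0⟩ := h
  obtain ⟨r, x, hr, hx⟩ := TensorProduct.exists_smul_eq_one_tmul K v
  refine ⟨x, ?_, FaithfulSMul.algebraMap_injective R K ?_⟩
  · rintro rfl
    rw [TensorProduct.tmul_zero] at hx
    exact smul_ne_zero hr hv hx
  · rw [← baseChange_one_tmul, ← hx, map_smul, map_smul, LinearMap.smul_apply, hv0, smul_zero,
      smul_zero, map_zero]

end BaseChange

/-- **Meyer's theorem.** Let `(Λ, q)` be a non-degenerate indefinite
integer lattice of rank at least 5. Then `Λ` contains a nonzero isotropic vector. -/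
theorem meyer_isotropic_vector
    {Λ : Type*} [AddCommGroup Λ] [Module ℤ Λ] [Module.Free ℤ Λ] [Module.Finite ℤ Λ]
    (q : Λ →ₗ[ℤ] Λ →ₗ[ℤ] ℤ)
    (hsymm : ∀ x y : Λ, q x y = q y x)
    (hnd : ∀ x : Λ, (∀ y : Λ, q x y = 0) → x = 0)
    (hindef : (∃ x : Λ, 0 < q x x) ∧ (∃ y : Λ, q y y < 0))
    (hrank : 5 ≤ Module.finrank ℤ Λ) :
    ∃ x : Λ, x ≠ 0 ∧ q x x = 0 := by
  obtain ⟨⟨x, hx⟩, y, hy⟩ := hindef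
  rw [← Int.cast_pos (R := ℚ), ← eq_intCast (algebraMap ℤ ℚ),
    ← LinearMap.BilinForm.baseChange_one_tmul] at hx
  rw [← Int.cast_lt_zero (R := ℚ), ← eq_intCast (algebraMap ℤ ℚ),
    ← LinearMap.BilinForm.baseChange_one_tmul] at hy
  exact LinearMap.BilinForm.exists_isotropic_of_baseChange ℚ
    (LinearMap.BilinForm.exists_isotropic_rat (LinearMap.BilinForm.IsSymm.baseChange ℚ ⟨hsymm⟩)
      (fun v => LinearMap.BilinForm.eq_zero_of_baseChange_eq_zero ℚ hnd) ⟨_, hx⟩ ⟨_, hy⟩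
      (by rwa [Module.finrank_baseChange]))
end
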